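/- arXiv:1902.05932 — 4 statements merged into one kernel-verified Lean document; each statement's English description precedes it below -/
import Mathlib

section
/- A finite positive Borel measure μ on the open unit disk 𝔻 is a Carleson measure for the Dirichlet space 𝒟 if and only if the supremum, over all g ∈ L²(μ) with ‖g‖_{L²(μ)} ≤ 1, of ∫_𝔻 ∫_𝔻 log(2/|1 − w̄z|) |g(z)| |g(w)| dμ(z) dμ(w) is finite. -/
open MeasureTheory Metric Complex Filter Set

noncomputable section

/-- Membership in the Dirichlet space: `f` is holomorphic on the unit disk and
its Dirichlet integral is finite. -/
def InDirichlet (f : ℂ → ℂ) : Prop :=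
  DifferentiableOn ℂ f (Metric.ball (0:ℂ) 1) ∧
    IntegrableOn (fun z => ‖deriv f z‖ ^ 2) (Metric.ball (0:ℂ) 1) volume

/-- The square of the Dirichlet norm: `‖f‖_𝒟² = |f(0)|² + (1/π)∫_𝔻 |f′|² dA`. -/
def dirichletNormSq (f : ℂ → ℂ) : ℝ :=
  ‖f 0‖ ^ 2 + (1 / Real.pi) * ∫ z in Metric.ball (0:ℂ) 1, ‖deriv f z‖ ^ 2

/-- `μ` is a Carleson measure for the Dirichlet space. -/
def IsCarlesonDirichlet (μ : Measure ℂ) : Prop :=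
  ∃ C : ℝ, ∀ f : ℂ → ℂ, InDirichlet f →
    ∫⁻ z in Metric.ball (0:ℂ) 1, ENNReal.ofReal (‖f z‖ ^ 2) ∂μ ≤
      ENNReal.ofReal (C * dirichletNormSq f)

/-- The Carleson box `S(I)` over the arc `I = {e^{iα} : θ ≤ α ≤ θ + ℓ}` of arclength `ℓ`. -/
def carlesonBox (θ ℓ : ℝ) : Set ℂ :=
  {z : ℂ | ∃ r α : ℝ, 1 - ℓ < r ∧ r < 1 ∧ θ ≤ α ∧ α ≤ θ + ℓ ∧
    z = r * Complex.exp (α * Complex.I)}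

open scoped ComplexConjugate Topology

lemma hasSum_of_forall_eq {f g : ℕ → ℂ} {a : ℂ} (h : HasSum f a) (e : ∀ n, f n = g n) :
    HasSum g a :=
  funext e ▸ h

/-- Monomials of different degrees are orthogonal on a disk, by rotation invariance. -/
lemma integral_ball_pow_mul_conj_pow_of_ne {m n : ℕ} (hmn : m ≠ n) (ρ : ℝ) :
    ∫ z in ball (0 : ℂ) ρ, z ^ m * conj z ^ n = 0 := by
  set t : ℝ := Real.pi / ((m : ℝ) - n) with ht
  have hsub : (m : ℝ) - n ≠ 0 := sub_ne_zero.mpr (by exact_mod_cast hmn)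
  set c : Circle := Circle.exp t with hc
  have hcc : (c : ℂ) ^ m * conj (c : ℂ) ^ n = -1 := by
    rw [hc, Circle.coe_exp, ← Complex.exp_conj, ← Complex.exp_nat_mul, ← Complex.exp_nat_mul,
      ← Complex.exp_add, ← Complex.exp_pi_mul_I]
    congr 1
    simp only [map_mul, Complex.conj_ofReal, Complex.conj_I]
    have : (Real.pi : ℂ) = ((m : ℂ) - n) * t := by
      have h2 : Real.pi = ((m : ℝ) - n) * t := by rw [ht]; field_simp
      exact_mod_cast congrArg (fun x : ℝ => (x : ℂ)) h2
    rw [this]; ring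
  have hmp : MeasurePreserving (rotation c) volume volume :=
    LinearIsometryEquiv.measurePreserving (rotation c)
  have h1 := hmp.setIntegral_preimage_emb
    (rotation c).toHomeomorph.measurableEmbedding (fun z : ℂ => z ^ m * conj z ^ n)
    (ball (0 : ℂ) ρ)
  have hpre : (rotation c) ⁻¹' (ball (0 : ℂ) ρ) = ball (0 : ℂ) ρ := by
    ext z
    rw [mem_preimage, mem_ball_zero_iff, mem_ball_zero_iff, LinearIsometryEquiv.norm_map]
  rw [hpre] at h1
  have h2 : ∀ z : ℂ, (rotation c z) ^ m * conj (rotation c z) ^ n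
      = -1 * (z ^ m * conj z ^ n) := by
    intro z
    rw [rotation_apply, map_mul, ← hcc]; ring
  simp_rw [h2] at h1
  rw [integral_const_mul] at h1
  have h3 := h1.symm
  rw [neg_one_mul] at h3
  exact self_eq_neg.mp h3

lemma integral_ball_pow_mul_conj_pow_self (n : ℕ) {ρ : ℝ} (hρ : 0 ≤ ρ) :
    ∫ z in ball (0 : ℂ) ρ, z ^ n * conj z ^ n
      = ((Real.pi * ρ ^ (2 * n + 2) / (n + 1) : ℝ) : ℂ) := by
  have h1 : ∀ z : ℂ, (ball (0 : ℂ) ρ).indicator (fun z => z ^ n * conj z ^ n) z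
      = (((Iio ρ).indicator (fun r : ℝ => r ^ (2 * n)) ‖z‖ : ℝ) : ℂ) := by
    intro z
    by_cases hz : ‖z‖ < ρ
    · rw [indicator_of_mem (by simpa using hz), indicator_of_mem (by simpa using hz),
        ← mul_pow, Complex.mul_conj, Complex.normSq_eq_norm_sq, pow_mul]
      push_cast; rfl
    · rw [indicator_of_notMem (by simpa using hz), indicator_of_notMem (by simpa using hz)]
      simp
  rw [← integral_indicator measurableSet_ball]
  simp_rw [h1]
  rw [integral_complex_ofReal]
  congr 1
  rw [integral_fun_norm_addHaar volume ((Iio ρ).indicator (fun r : ℝ => r ^ (2 * n)))]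
  have h2 : ∀ y : ℝ, y ^ (Module.finrank ℝ ℂ - 1) • (Iio ρ).indicator (fun r : ℝ => r ^ (2 * n)) y
      = (Iio ρ).indicator (fun r : ℝ => r ^ (2 * n + 1)) y := by
    intro y
    by_cases hy : y < ρ
    · simp only [mem_Iio, hy, indicator_of_mem, Complex.finrank_real_complex, smul_eq_mul]
      ring
    · simp [hy]
  simp_rw [h2]
  rw [setIntegral_indicator measurableSet_Iio, Ioi_inter_Iio, ← integral_Ioc_eq_integral_Ioo,
    ← intervalIntegral.integral_of_le hρ, integral_pow]
  simp [Measure.real, Complex.volume_ball]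
  field_simp
  ring

/-- Parseval's identity for polynomials on a disk. -/
lemma integral_ball_norm_sq_sum (b : ℕ → ℂ) (N : ℕ) {ρ : ℝ} (hρ : 0 ≤ ρ) :
    ∫ z in ball (0 : ℂ) ρ, ‖∑ n ∈ Finset.range N, b n * z ^ n‖ ^ 2
      = ∑ n ∈ Finset.range N, ‖b n‖ ^ 2 * (Real.pi * ρ ^ (2 * n + 2) / (n + 1)) := by
  have hint : ∀ f : ℂ → ℂ, Continuous f → IntegrableOn f (ball (0 : ℂ) ρ) := fun f hf =>
    (hf.continuousOn.integrableOn_compact (isCompact_closedBall 0 ρ)).mono_set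
      ball_subset_closedBall
  have h1 : ∀ z : ℂ, ((‖∑ n ∈ Finset.range N, b n * z ^ n‖ ^ 2 : ℝ) : ℂ)
      = ∑ m ∈ Finset.range N, ∑ n ∈ Finset.range N,
          (b m * conj (b n)) * (z ^ m * conj z ^ n) := by
    intro z
    rw [← Complex.normSq_eq_norm_sq, ← Complex.mul_conj, map_sum, Finset.sum_mul_sum]
    refine Finset.sum_congr rfl fun m _ => Finset.sum_congr rfl fun n _ => ?_
    rw [map_mul, map_pow]; ring
  apply Complex.ofReal_injective
  rw [← integral_complex_ofReal]
  simp_rw [h1]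
  rw [integral_finsetSum _ fun m _ => hint _ (by fun_prop), Complex.ofReal_sum]
  refine Finset.sum_congr rfl fun m hm => ?_
  rw [integral_finsetSum _ fun n _ => hint _ (by fun_prop), Finset.sum_eq_single m]
  · rw [integral_const_mul, integral_ball_pow_mul_conj_pow_self m hρ, Complex.mul_conj,
      Complex.normSq_eq_norm_sq]
    push_cast; rfl
  · intro n _ hn
    rw [integral_const_mul, integral_ball_pow_mul_conj_pow_of_ne hn.symm, mul_zero]
  · exact fun h => absurd hm h

/-- Bessel's inequality on the unit disk. -/
lemma sum_le_integral_ball_norm_sq {F : ℂ → ℂ} {b : ℕ → ℂ}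
    (hF : ∀ z ∈ ball (0 : ℂ) 1, HasSum (fun n => b n * z ^ n) (F z))
    (hFi : IntegrableOn (fun z => ‖F z‖ ^ 2) (ball (0 : ℂ) 1)) (N : ℕ) :
    ∑ n ∈ Finset.range N, ‖b n‖ ^ 2 * (Real.pi / (n + 1))
      ≤ ∫ z in ball (0 : ℂ) 1, ‖F z‖ ^ 2 := by
  have key : ∀ ρ ∈ Ioo (0 : ℝ) 1,
      ∑ n ∈ Finset.range N, ‖b n‖ ^ 2 * (Real.pi * ρ ^ (2 * n + 2) / (n + 1))
        ≤ ∫ z in ball (0 : ℂ) 1, ‖F z‖ ^ 2 := by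
    intro ρ hρ
    have hsum : Summable fun n => ‖b n‖ * ρ ^ n := by
      have h := (hF (ρ : ℂ) (by simp [abs_of_pos hρ.1, hρ.2])).summable.norm
      simpa [abs_of_pos hρ.1] using h
    have hball : ball (0 : ℂ) ρ ⊆ ball (0 : ℂ) 1 := ball_subset_ball hρ.2.le
    have hlim : Tendsto
        (fun K => ∫ z in ball (0 : ℂ) ρ, ‖∑ n ∈ Finset.range K, b n * z ^ n‖ ^ 2) atTop
        (𝓝 (∫ z in ball (0 : ℂ) ρ, ‖F z‖ ^ 2)) := by
      refine tendsto_integral_of_dominated_convergence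
        (fun _ => (∑' n, ‖b n‖ * ρ ^ n) ^ 2) (fun K => ?_) ?_ (fun K => ?_) ?_
      · exact Continuous.aestronglyMeasurable (by fun_prop)
      · have : IsFiniteMeasure (volume.restrict (ball (0 : ℂ) ρ)) :=
          ⟨by rw [Measure.restrict_apply_univ]; exact measure_ball_lt_top⟩
        exact integrable_const _
      · refine (ae_restrict_iff' measurableSet_ball).mpr (ae_of_all _ fun z hz => ?_)
        rw [Real.norm_of_nonneg (by positivity)]
        refine pow_le_pow_left₀ (norm_nonneg _) ?_ 2
        refine (norm_sum_le _ _).trans (le_trans (Finset.sum_le_sum fun n _ => ?_)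
          (hsum.sum_le_tsum (Finset.range K)
            fun n _ => mul_nonneg (norm_nonneg _) (pow_nonneg hρ.1.le n)))
        rw [norm_mul, norm_pow]
        have : ‖z‖ ≤ ρ := by simpa using (mem_ball_zero_iff.mp hz).le
        gcongr
      · refine (ae_restrict_iff' measurableSet_ball).mpr (ae_of_all _ fun z hz => ?_)
        exact ((hF z (hball hz)).tendsto_sum_nat.norm).pow 2
    have h1 : ∑ n ∈ Finset.range N, ‖b n‖ ^ 2 * (Real.pi * ρ ^ (2 * n + 2) / (n + 1))
        ≤ ∫ z in ball (0 : ℂ) ρ, ‖F z‖ ^ 2 := by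
      refine ge_of_tendsto hlim (eventually_atTop.mpr ⟨N, fun K hK => ?_⟩)
      rw [integral_ball_norm_sq_sum b K hρ.1.le]
      have := hρ.1
      exact Finset.sum_le_sum_of_subset_of_nonneg (Finset.range_mono hK)
        fun n _ _ => by have := Real.pi_pos; positivity
    exact h1.trans (setIntegral_mono_set hFi (ae_of_all _ fun z => by positivity)
      hball.eventuallyLE)
  have hc : Tendsto
      (fun ρ : ℝ => ∑ n ∈ Finset.range N, ‖b n‖ ^ 2 * (Real.pi * ρ ^ (2 * n + 2) / (n + 1)))
      (𝓝[<] 1) (𝓝 (∑ n ∈ Finset.range N, ‖b n‖ ^ 2 * (Real.pi * 1 ^ (2 * n + 2) / (n + 1)))) :=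
    (Continuous.tendsto (by fun_prop) 1).mono_left nhdsWithin_le_nhds
  have := le_of_tendsto hc (by
    filter_upwards [Ioo_mem_nhdsLT (zero_lt_one' ℝ)] with ρ hρ using key ρ hρ)
  simpa using this

/-- The squared Dirichlet norm of `z ^ n`. -/
def dirichletWeight (n : ℕ) : ℝ := max n 1

lemma dirichletWeight_pos (n : ℕ) : 0 < dirichletWeight n :=
  lt_max_of_lt_right one_pos

lemma one_le_dirichletWeight (n : ℕ) : 1 ≤ dirichletWeight n := le_max_right _ _

@[simp] lemma dirichletWeight_zero : dirichletWeight 0 = 1 := by simp [dirichletWeight]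

@[simp] lemma dirichletWeight_succ (n : ℕ) : dirichletWeight (n + 1) = n + 1 := by
  simp [dirichletWeight]

lemma deriv_sum_range_succ_mul_pow (a : ℕ → ℂ) (N : ℕ) (z : ℂ) :
    deriv (fun z : ℂ => ∑ n ∈ Finset.range (N + 1), a n * z ^ n) z
      = ∑ n ∈ Finset.range N, ((n + 1) * a (n + 1)) * z ^ n := by
  have h : HasDerivAt (fun z : ℂ => ∑ n ∈ Finset.range (N + 1), a n * z ^ n)
      (∑ n ∈ Finset.range (N + 1), a n * (n * z ^ (n - 1))) z :=
    HasDerivAt.fun_sum fun n _ => (hasDerivAt_pow n z).const_mul (a n)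
  rw [h.deriv, Finset.sum_range_succ']
  simp only [Nat.cast_zero, zero_mul, mul_zero, add_zero, Nat.add_sub_cancel]
  refine Finset.sum_congr rfl fun n _ => ?_
  push_cast
  ring

lemma inDirichlet_polynomial (a : ℕ → ℂ) (N : ℕ) :
    InDirichlet fun z : ℂ => ∑ n ∈ Finset.range (N + 1), a n * z ^ n := by
  refine ⟨by fun_prop, ?_⟩
  simp_rw [deriv_sum_range_succ_mul_pow]
  exact (Continuous.locallyIntegrable (by fun_prop)).integrableOn_isCompact
    (isCompact_closedBall (0 : ℂ) 1) |>.mono_set ball_subset_closedBall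

lemma norm_succ_mul_sq (n : ℕ) (a : ℂ) :
    ‖((n : ℂ) + 1) * a‖ ^ 2 = ((n : ℝ) + 1) ^ 2 * ‖a‖ ^ 2 := by
  rw [norm_mul, mul_pow]
  congr 2
  exact_mod_cast Complex.norm_natCast (n + 1)

lemma dirichletNormSq_polynomial (a : ℕ → ℂ) (N : ℕ) :
    dirichletNormSq (fun z : ℂ => ∑ n ∈ Finset.range (N + 1), a n * z ^ n)
      = ∑ n ∈ Finset.range (N + 1), dirichletWeight n * ‖a n‖ ^ 2 := by
  unfold dirichletNormSq
  simp_rw [deriv_sum_range_succ_mul_pow]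
  rw [integral_ball_norm_sq_sum _ N zero_le_one, Finset.mul_sum,
    Finset.sum_range_succ' (fun n => dirichletWeight n * _),
    Finset.sum_range_succ' (fun n => a n * _), add_comm]
  congr 1
  · refine Finset.sum_congr rfl fun n _ => ?_
    rw [norm_succ_mul_sq, dirichletWeight_succ]
    have := Real.pi_pos
    have : (n : ℝ) + 1 ≠ 0 := by positivity
    field_simp
    simp
  · simp

/-- A function in the Dirichlet space has a power series whose weighted `ℓ²` norm is controlled
by the Dirichlet norm. -/
lemma InDirichlet.exists_hasSum {f : ℂ → ℂ} (hf : InDirichlet f) :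
    ∃ a : ℕ → ℂ, (∀ z ∈ ball (0 : ℂ) 1, HasSum (fun n => a n * z ^ n) (f z)) ∧
      ∀ N, ∑ n ∈ Finset.range (N + 1), dirichletWeight n * ‖a n‖ ^ 2 ≤ dirichletNormSq f := by
  refine ⟨fun n => (n.factorial : ℂ)⁻¹ * iteratedDeriv n f 0, fun z hz => ?_, fun N => ?_⟩
  · refine hasSum_of_forall_eq (Complex.hasSum_taylorSeries_on_ball hf.1 hz) fun n => ?_
    simp only [smul_eq_mul, sub_zero]; ring
  · have h1 : ∀ z ∈ ball (0 : ℂ) 1, HasSum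
        (fun n : ℕ => (((n : ℂ) + 1) * (((n + 1).factorial : ℂ)⁻¹ * iteratedDeriv (n + 1) f 0)) * z ^ n)
        (deriv f z) := by
      intro z hz
      refine hasSum_of_forall_eq
        (Complex.hasSum_taylorSeries_on_ball (hf.1.deriv isOpen_ball) hz) fun n => ?_
      simp only [smul_eq_mul, sub_zero, iteratedDeriv_succ', Nat.factorial_succ]
      have : (n.factorial : ℂ) ≠ 0 := by exact_mod_cast n.factorial_ne_zero
      have : (n : ℂ) + 1 ≠ 0 := by exact_mod_cast n.succ_ne_zero
      push_cast
      field_simp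
    have h2 := sum_le_integral_ball_norm_sq h1 hf.2 N
    unfold dirichletNormSq
    rw [Finset.sum_range_succ', add_comm]
    refine add_le_add (by simp) ?_
    have hpi := Real.pi_pos
    calc _ = (1 / Real.pi) * ∑ n ∈ Finset.range N,
          ‖((n : ℂ) + 1) * (((n + 1).factorial : ℂ)⁻¹ * iteratedDeriv (n + 1) f 0)‖ ^ 2
            * (Real.pi / (n + 1)) := by
          rw [Finset.mul_sum]
          refine Finset.sum_congr rfl fun n _ => ?_
          rw [norm_succ_mul_sq, dirichletWeight_succ]
          have : (n : ℝ) + 1 ≠ 0 := by positivity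
          field_simp
      _ ≤ _ := mul_le_mul_of_nonneg_left h2 (by positivity)

/-- The reproducing kernel of the Dirichlet space is `dirichletKernel (conj w * z)`. -/
def dirichletKernel (ζ : ℂ) : ℂ := 1 - Complex.log (1 - ζ)

lemma measurable_dirichletKernel : Measurable dirichletKernel := by
  unfold dirichletKernel; fun_prop

lemma hasSum_dirichletKernel {ζ : ℂ} (hζ : ‖ζ‖ < 1) :
    HasSum (fun n => ζ ^ n / (dirichletWeight n : ℂ)) (dirichletKernel ζ) := by
  have h := (hasSum_ite_eq (0 : ℕ) (1 : ℂ)).add (Complex.hasSum_taylorSeries_neg_log hζ)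
  rw [← sub_eq_add_neg] at h
  refine hasSum_of_forall_eq h fun n => ?_
  cases n <;> simp

lemma dirichletKernel_re (ζ : ℂ) : (dirichletKernel ζ).re = 1 - Real.log ‖1 - ζ‖ := by
  simp [dirichletKernel, Complex.log_re]

lemma norm_one_sub_pos {ζ : ℂ} (hζ : ‖ζ‖ < 1) : 0 < ‖1 - ζ‖ := by
  have := norm_sub_norm_le (1 : ℂ) ζ
  rw [norm_one] at this; linarith

lemma norm_one_sub_le_two {ζ : ℂ} (hζ : ‖ζ‖ < 1) : ‖1 - ζ‖ ≤ 2 := by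
  have := norm_sub_le (1 : ℂ) ζ
  rw [norm_one] at this; linarith

lemma log_two_div_norm_one_sub {ζ : ℂ} (hζ : ‖ζ‖ < 1) :
    Real.log (2 / ‖1 - ζ‖) = Real.log 2 - Real.log ‖1 - ζ‖ :=
  Real.log_div two_ne_zero (norm_one_sub_pos hζ).ne'

lemma log_two_div_norm_one_sub_nonneg {ζ : ℂ} (hζ : ‖ζ‖ < 1) :
    0 ≤ Real.log (2 / ‖1 - ζ‖) :=
  Real.log_nonneg ((one_le_div (norm_one_sub_pos hζ)).mpr (norm_one_sub_le_two hζ))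

lemma norm_ofReal_mul_lt_one {r : ℝ} (hr : r ∈ Ico (0 : ℝ) 1) {ζ : ℂ} (hζ : ‖ζ‖ < 1) :
    ‖(r : ℂ) * ζ‖ < 1 := by
  rw [norm_mul, Complex.norm_real, Real.norm_of_nonneg hr.1]
  nlinarith [hr.1, hr.2, norm_nonneg ζ]

lemma norm_one_sub_le_two_mul {r : ℝ} (hr : r ∈ Ico (0 : ℝ) 1) {ζ : ℂ} (hζ : ‖ζ‖ < 1) :
    ‖1 - ζ‖ ≤ 2 * ‖1 - (r : ℂ) * ζ‖ := by
  have h1 : ‖1 - ζ‖ ≤ ‖1 - (r : ℂ) * ζ‖ + (1 - r) * ‖ζ‖ := by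
    have : 1 - ζ = (1 - (r : ℂ) * ζ) - ((1 - r : ℝ) : ℂ) * ζ := by push_cast; ring
    rw [this]
    refine (norm_sub_le _ _).trans_eq ?_
    rw [norm_mul ((1 - r : ℝ) : ℂ), Complex.norm_real, Real.norm_of_nonneg (by linarith [hr.2])]
  have h2 : 1 - r * ‖ζ‖ ≤ ‖1 - (r : ℂ) * ζ‖ := by
    have := norm_sub_norm_le (1 : ℂ) (r * ζ)
    rwa [norm_one, norm_mul, Complex.norm_real, Real.norm_of_nonneg hr.1] at this
  nlinarith [hr.1, hr.2, norm_nonneg ζ]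

lemma norm_dirichletKernel_le {r : ℝ} (hr : r ∈ Ico (0 : ℝ) 1) {ζ : ℂ} (hζ : ‖ζ‖ < 1) :
    ‖dirichletKernel (r * ζ)‖ ≤ Real.log (2 / ‖1 - ζ‖) + 8 := by
  have hrζ := norm_ofReal_mul_lt_one hr hζ
  have hpos := norm_one_sub_pos hrζ
  have h1 : Real.log ‖1 - ζ‖ ≤ Real.log 2 + Real.log ‖1 - (r : ℂ) * ζ‖ := by
    rw [← Real.log_mul two_ne_zero hpos.ne']
    exact Real.log_le_log (norm_one_sub_pos hζ) (norm_one_sub_le_two_mul hr hζ)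
  have h2 : Real.log ‖1 - (r : ℂ) * ζ‖ ≤ Real.log 2 :=
    Real.log_le_log hpos (norm_one_sub_le_two hrζ)
  have h3 := Real.log_two_lt_d9
  have h4 := log_two_div_norm_one_sub_nonneg hζ
  have h5 := log_two_div_norm_one_sub hζ
  have h6 : |(dirichletKernel (r * ζ)).im| ≤ Real.pi := by
    simpa [dirichletKernel, Complex.log_im] using Complex.abs_arg_le_pi (1 - r * ζ)
  have h7 : |(dirichletKernel (r * ζ)).re| ≤ Real.log (2 / ‖1 - ζ‖) + 2 := by
    rw [dirichletKernel_re, abs_le]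
    constructor <;> linarith
  have h8 := Complex.norm_le_abs_re_add_abs_im (dirichletKernel (r * ζ))
  linarith [Real.pi_lt_four]

section Energy

variable {ν : Measure ℂ}

lemma integrable_conj_pow_mul (hν : ∀ᵐ z ∂ν, ‖z‖ < 1) {h : ℂ → ℂ} (hh : Integrable h ν) (n : ℕ) :
    Integrable (fun w => conj w ^ n * h w) ν := by
  refine hh.bdd_mul (c := 1) (Continuous.aestronglyMeasurable (by fun_prop)) ?_
  filter_upwards [hν] with w hw
  rw [norm_pow, RCLike.norm_conj]
  exact pow_le_one₀ (norm_nonneg _) hw.le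

lemma ae_prod_norm_lt_one [SFinite ν] (hν : ∀ᵐ z ∂ν, ‖z‖ < 1) :
    ∀ᵐ p ∂ν.prod ν, ‖p.1‖ < 1 ∧ ‖p.2‖ < 1 :=
  (Measure.quasiMeasurePreserving_fst.ae hν).and (Measure.quasiMeasurePreserving_snd.ae hν)

lemma norm_conj_mul_lt_one {w z : ℂ} (hw : ‖w‖ < 1) (hz : ‖z‖ < 1) : ‖conj w * z‖ < 1 := by
  rw [norm_mul, RCLike.norm_conj]
  nlinarith [norm_nonneg w, norm_nonneg z]

/-- The energy integral of `h` against the dilated reproducing kernel, expanded in moments. -/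
lemma hasSum_energy [SFinite ν] (hν : ∀ᵐ z ∂ν, ‖z‖ < 1) {h : ℂ → ℂ} (hh : Integrable h ν) {r : ℝ}
    (hr : r ∈ Ico (0 : ℝ) 1) :
    Integrable (fun p : ℂ × ℂ => dirichletKernel (r * (conj p.1 * p.2)) * (h p.1 * conj (h p.2)))
      (ν.prod ν) ∧
    HasSum (fun n => ((r ^ n / dirichletWeight n * ‖∫ w, conj w ^ n * h w ∂ν‖ ^ 2 : ℝ) : ℂ))
      (∫ p, dirichletKernel (r * (conj p.1 * p.2)) * (h p.1 * conj (h p.2)) ∂ν.prod ν) := by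
  have hh2 : Integrable (fun z => conj (h z)) ν :=
    (Complex.conjLIE.integrable_comp_iff (φ := h)).mpr hh
  have hH : Integrable (fun p : ℂ × ℂ => h p.1 * conj (h p.2)) (ν.prod ν) := hh.mul_prod hh2
  have hdisk := ae_prod_norm_lt_one hν
  have hgeo : HasSum (fun n => r ^ n) (1 - r)⁻¹ := hasSum_geometric_of_lt_one hr.1 hr.2
  set F : ℕ → ℂ × ℂ → ℂ := fun n p =>
    (r * (conj p.1 * p.2)) ^ n / (dirichletWeight n : ℂ) * (h p.1 * conj (h p.2)) with hF
  have hFm : ∀ n, AEStronglyMeasurable (F n) (ν.prod ν) := fun n =>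
    (Continuous.aestronglyMeasurable (by fun_prop)).mul hH.aestronglyMeasurable
  have hcoef : ∀ n, ∀ p : ℂ × ℂ, ‖p.1‖ < 1 → ‖p.2‖ < 1 →
      ‖(r * (conj p.1 * p.2)) ^ n / (dirichletWeight n : ℂ)‖ ≤ r ^ n := by
    intro n p h1 h2
    rw [norm_div, norm_pow, norm_mul, Complex.norm_real, Complex.norm_real,
      Real.norm_of_nonneg hr.1, Real.norm_of_nonneg (dirichletWeight_pos n).le, mul_pow]
    refine (div_le_self (mul_nonneg (pow_nonneg hr.1 n) (by positivity))
      (one_le_dirichletWeight n)).trans ?_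
    exact mul_le_of_le_one_right (pow_nonneg hr.1 n)
      (pow_le_one₀ (norm_nonneg _) (norm_conj_mul_lt_one h1 h2).le)
  have hFb : ∀ n, ∀ᵐ p ∂ν.prod ν, ‖F n p‖ ≤ r ^ n * ‖h p.1 * conj (h p.2)‖ := by
    intro n
    filter_upwards [hdisk] with p hp
    rw [hF, norm_mul]
    exact mul_le_mul_of_nonneg_right (hcoef n p hp.1 hp.2) (norm_nonneg _)
  have hlim : ∀ᵐ p ∂ν.prod ν, HasSum (fun n => F n p)
      (dirichletKernel (r * (conj p.1 * p.2)) * (h p.1 * conj (h p.2))) := by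
    filter_upwards [hdisk] with p hp
    exact (hasSum_dirichletKernel
      (norm_ofReal_mul_lt_one hr (norm_conj_mul_lt_one hp.1 hp.2))).mul_right _
  have hbi : Integrable (fun p => ∑' n, r ^ n * ‖h p.1 * conj (h p.2)‖) (ν.prod ν) := by
    simp_rw [tsum_mul_right]
    exact hH.norm.const_mul _
  have hbs : ∀ p : ℂ × ℂ, Summable fun n => r ^ n * ‖h p.1 * conj (h p.2)‖ :=
    fun p => hgeo.summable.mul_right _
  constructor
  · have hkm : Measurable fun p : ℂ × ℂ => dirichletKernel (r * (conj p.1 * p.2)) :=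
      measurable_dirichletKernel.comp (Continuous.measurable (by fun_prop))
    refine hbi.mono' (hkm.aestronglyMeasurable.mul hH.aestronglyMeasurable) ?_
    filter_upwards [hlim, ae_all_iff.mpr hFb] with p hp hb
    exact hp.norm_le_of_bounded (hbs p).hasSum hb
  · have := hasSum_integral_of_dominated_convergence (μ := ν.prod ν) (F := F)
      (fun (n : ℕ) (p : ℂ × ℂ) => r ^ n * ‖h p.1 * conj (h p.2)‖) hFm hFb
      (Eventually.of_forall hbs) hbi hlim
    refine hasSum_of_forall_eq this fun n => ?_
    have h1 : ∀ p : ℂ × ℂ, F n p = ((r ^ n / dirichletWeight n : ℝ) : ℂ) *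
        ((conj p.1 ^ n * h p.1) * conj (conj p.2 ^ n * h p.2)) := by
      intro p
      simp only [hF, map_mul, map_pow, Complex.conj_conj]
      push_cast; ring
    simp_rw [h1]
    rw [integral_const_mul,
      integral_prod_mul (fun w => conj w ^ n * h w) (fun w => conj (conj w ^ n * h w)),
      integral_conj, Complex.mul_conj, Complex.normSq_eq_norm_sq]
    push_cast; rfl

end Energy

section Duality

variable {ν : Measure ℂ}

/-- The conjugate moments `∫ w̄ⁿ h(w) dν(w)`. -/
def conjMoment (ν : Measure ℂ) (h : ℂ → ℂ) (n : ℕ) : ℂ := ∫ w, conj w ^ n * h w ∂ν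

lemma integral_polynomial_mul_conj (hν : ∀ᵐ z ∂ν, ‖z‖ < 1) {h : ℂ → ℂ} (hh : Integrable h ν)
    (a : ℕ → ℂ) (N : ℕ) :
    ∫ z, (∑ n ∈ Finset.range N, a n * z ^ n) * conj (h z) ∂ν
      = ∑ n ∈ Finset.range N, a n * conj (conjMoment ν h n) := by
  have hi : ∀ n, Integrable (fun z => conj (conj z ^ n * h z)) ν := fun n =>
    Complex.conjLIE.integrable_comp_iff.mpr (integrable_conj_pow_mul hν hh n)
  have h1 : ∀ z, (∑ n ∈ Finset.range N, a n * z ^ n) * conj (h z)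
      = ∑ n ∈ Finset.range N, a n * conj (conj z ^ n * h z) := by
    intro z
    rw [Finset.sum_mul]
    refine Finset.sum_congr rfl fun n _ => ?_
    simp only [map_mul, map_pow, Complex.conj_conj]; ring
  simp_rw [h1]
  rw [integral_finsetSum _ fun n _ => (hi n).const_mul (a n)]
  simp_rw [integral_const_mul, integral_conj, conjMoment]

variable [IsFiniteMeasure ν]

lemma integrable_of_continuous (hν : ∀ᵐ z ∂ν, ‖z‖ < 1) {E : Type*} [NormedAddCommGroup E]
    {f : ℂ → E} (hf : Continuous f) : Integrable f ν := by
  obtain ⟨B, hB⟩ := (isCompact_closedBall (0 : ℂ) 1).exists_bound_of_continuousOn hf.continuousOn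
  have hsm : StronglyMeasurable f := hf.stronglyMeasurable
  refine Integrable.of_bound hsm.aestronglyMeasurable B ?_
  filter_upwards [hν] with z hz
  exact hB z (by simpa using hz.le)

lemma ofReal_norm_sq_integrable {g : ℂ → ℂ} (hg : AEMeasurable g ν)
    (hg2 : ∫⁻ z, ENNReal.ofReal (‖g z‖ ^ 2) ∂ν ≤ 1) :
    Integrable g ν ∧ Integrable (fun z => ‖g z‖ ^ 2) ν ∧ ∫ z, ‖g z‖ ^ 2 ∂ν ≤ 1 := by
  have h2 : Integrable (fun z => ‖g z‖ ^ 2) ν := by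
    refine ⟨(hg.norm.pow_const 2).aestronglyMeasurable, ?_⟩
    rw [hasFiniteIntegral_iff_ofReal (ae_of_all _ fun z => by positivity)]
    exact hg2.trans_lt ENNReal.one_lt_top
  refine ⟨?_, h2, ?_⟩
  · refine ((integrable_const (1 : ℝ)).add h2).mono' hg.aestronglyMeasurable
      (ae_of_all _ fun z => ?_)
    simp only [Pi.add_apply]
    nlinarith [sq_nonneg (‖g z‖ - 1), norm_nonneg (g z)]
  · rw [← ofReal_integral_eq_lintegral_ofReal h2 (ae_of_all _ fun z => by positivity)] at hg2
    simpa using hg2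

lemma integral_norm_le {g : ℂ → ℂ} (hg : Integrable g ν) (h2 : Integrable (fun z => ‖g z‖ ^ 2) ν)
    (h1 : ∫ z, ‖g z‖ ^ 2 ∂ν ≤ 1) : ∫ z, ‖g z‖ ∂ν ≤ ν.real univ + 1 := by
  calc ∫ z, ‖g z‖ ∂ν ≤ ∫ z, (1 + ‖g z‖ ^ 2) ∂ν := by
        refine integral_mono hg.norm ((integrable_const _).add h2) fun z => ?_
        simp only
        nlinarith [sq_nonneg (‖g z‖ - 1), norm_nonneg (g z)]
    _ ≤ _ := by
        rw [integral_add (integrable_const _) h2, integral_const]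
        simpa using h1

/-- The Carleson embedding bounds the adjoint embedding. -/
lemma sum_conjMoment_le_of_carleson (hν : ∀ᵐ z ∂ν, ‖z‖ < 1) {C : ℝ} (hC : 0 < C)
    (hcar : ∀ f : ℂ → ℂ, InDirichlet f →
      ∫⁻ z, ENNReal.ofReal (‖f z‖ ^ 2) ∂ν ≤ ENNReal.ofReal (C * dirichletNormSq f))
    {h : ℂ → ℂ} (hh : Integrable h ν) (hh2 : Integrable (fun z => ‖h z‖ ^ 2) ν)
    (hh1 : ∫ z, ‖h z‖ ^ 2 ∂ν ≤ 1) (N : ℕ) :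
    ∑ n ∈ Finset.range (N + 1), ‖conjMoment ν h n‖ ^ 2 / dirichletWeight n ≤ C := by
  set d := conjMoment ν h with hd
  set S := ∑ n ∈ Finset.range (N + 1), ‖d n‖ ^ 2 / dirichletWeight n with hS
  set f : ℂ → ℂ := fun z => ∑ n ∈ Finset.range (N + 1), (d n / (dirichletWeight n : ℂ)) * z ^ n
    with hf
  have hS0 : 0 ≤ S := Finset.sum_nonneg fun n _ =>
    div_nonneg (by positivity) (dirichletWeight_pos n).le
  have hf2 : Integrable (fun z => ‖f z‖ ^ 2) ν := integrable_of_continuous hν (by fun_prop)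
  have hnorm : dirichletNormSq f = S := by
    rw [hf, dirichletNormSq_polynomial]
    refine Finset.sum_congr rfl fun n _ => ?_
    have := dirichletWeight_pos n
    rw [norm_div, Complex.norm_real, Real.norm_of_nonneg this.le]
    field_simp
  have hfC : ∫ z, ‖f z‖ ^ 2 ∂ν ≤ C * S := by
    have h1 := hcar f (inDirichlet_polynomial _ N)
    rw [← ofReal_integral_eq_lintegral_ofReal hf2 (ae_of_all _ fun z => by positivity),
      hnorm] at h1
    exact (ENNReal.ofReal_le_ofReal_iff (by positivity)).mp h1
  have hpair : ∫ z, f z * conj (h z) ∂ν = (S : ℂ) := by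
    rw [hf, integral_polynomial_mul_conj hν hh, hS, Complex.ofReal_sum]
    refine Finset.sum_congr rfl fun n _ => ?_
    rw [div_mul_eq_mul_div, ← hd, Complex.mul_conj, Complex.normSq_eq_norm_sq]
    push_cast; rfl
  have hle : ‖∫ z, f z * conj (h z) ∂ν‖ ≤ ∫ z, ((2 * C)⁻¹ * ‖f z‖ ^ 2 + C / 2 * ‖h z‖ ^ 2) ∂ν := by
    refine norm_integral_le_of_norm_le ((hf2.const_mul _).add (hh2.const_mul _))
      (ae_of_all _ fun z => ?_)
    rw [norm_mul, RCLike.norm_conj]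
    have h1 : (2 * C)⁻¹ * ‖f z‖ ^ 2 + C / 2 * ‖h z‖ ^ 2 - ‖f z‖ * ‖h z‖
        = (2 * C)⁻¹ * (‖f z‖ - C * ‖h z‖) ^ 2 := by
      field_simp; ring
    have h2 : 0 ≤ (2 * C)⁻¹ * (‖f z‖ - C * ‖h z‖) ^ 2 := by positivity
    linarith
  rw [hpair, Complex.norm_real, Real.norm_of_nonneg hS0,
    integral_add (hf2.const_mul _) (hh2.const_mul _), integral_const_mul,
    integral_const_mul] at hle
  have h3 : (2 * C)⁻¹ * ∫ z, ‖f z‖ ^ 2 ∂ν ≤ S / 2 := by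
    refine (mul_le_mul_of_nonneg_left hfC (by positivity)).trans_eq ?_
    field_simp
  have h4 : C / 2 * ∫ z, ‖h z‖ ^ 2 ∂ν ≤ C / 2 := mul_le_of_le_one_right (by positivity) hh1
  linarith

/-- A bound for the adjoint embedding gives the Carleson embedding for polynomials. -/
lemma integral_norm_sq_polynomial_le (hν : ∀ᵐ z ∂ν, ‖z‖ < 1) {C : ℝ} (hC : 0 ≤ C)
    (hmom : ∀ h : ℂ → ℂ, Integrable h ν → Integrable (fun z => ‖h z‖ ^ 2) ν →
      ∫ z, ‖h z‖ ^ 2 ∂ν ≤ 1 → ∀ N,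
        ∑ n ∈ Finset.range N, ‖conjMoment ν h n‖ ^ 2 / dirichletWeight n ≤ C)
    (a : ℕ → ℂ) (N : ℕ) :
    ∫ z, ‖∑ n ∈ Finset.range N, a n * z ^ n‖ ^ 2 ∂ν
      ≤ C * ∑ n ∈ Finset.range N, dirichletWeight n * ‖a n‖ ^ 2 := by
  set f : ℂ → ℂ := fun z => ∑ n ∈ Finset.range N, a n * z ^ n with hf
  set X := ∫ z, ‖f z‖ ^ 2 ∂ν with hX
  have hA : 0 ≤ ∑ n ∈ Finset.range N, dirichletWeight n * ‖a n‖ ^ 2 :=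
    Finset.sum_nonneg fun n _ => mul_nonneg (dirichletWeight_pos n).le (by positivity)
  have hX0 : 0 ≤ X := integral_nonneg fun z => by positivity
  rcases hX0.eq_or_lt with h0 | hpos
  · change X ≤ _
    rw [← h0]; positivity
  have hs : 0 < √X := Real.sqrt_pos.mpr hpos
  set h : ℂ → ℂ := fun z => ((√X)⁻¹ : ℝ) * f z with hh
  have hhc : Continuous h := by fun_prop
  have hh2 : ∫ z, ‖h z‖ ^ 2 ∂ν = 1 := by
    simp only [hh, norm_mul, Complex.norm_real, mul_pow]
    rw [integral_const_mul, ← hX, Real.norm_of_nonneg (by positivity), inv_pow,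
      Real.sq_sqrt hX0, inv_mul_cancel₀ hpos.ne']
  have hm := hmom h (integrable_of_continuous hν hhc)
    (integrable_of_continuous hν (by fun_prop)) hh2.le N
  have hpair : ∫ z, f z * conj (h z) ∂ν = ((√X : ℝ) : ℂ) := by
    have h1 : ∀ z, f z * conj (h z) = (((√X)⁻¹ * ‖f z‖ ^ 2 : ℝ) : ℂ) := by
      intro z
      rw [hh]
      simp only [map_mul, Complex.conj_ofReal]
      rw [mul_left_comm, Complex.mul_conj, Complex.normSq_eq_norm_sq]
      push_cast; rfl
    simp_rw [h1]
    rw [integral_complex_ofReal, integral_const_mul, ← hX]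
    congr 1
    rw [inv_mul_eq_div, Real.div_sqrt]
  rw [hf, integral_polynomial_mul_conj hν (integrable_of_continuous hν hhc)] at hpair
  have hle : √X ≤ ∑ n ∈ Finset.range N, ‖a n‖ * ‖conjMoment ν h n‖ := by
    have h1 := congrArg norm hpair
    rw [Complex.norm_real, Real.norm_of_nonneg hs.le] at h1
    rw [← h1]
    refine (norm_sum_le _ _).trans_eq (Finset.sum_congr rfl fun n _ => ?_)
    rw [norm_mul, RCLike.norm_conj]
  have hcs := Finset.sum_sq_le_sum_mul_sum_of_sq_le_mul (Finset.range N)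
    (r := fun n => ‖a n‖ * ‖conjMoment ν h n‖) (f := fun n => dirichletWeight n * ‖a n‖ ^ 2)
    (g := fun n => ‖conjMoment ν h n‖ ^ 2 / dirichletWeight n)
    (fun n _ => mul_nonneg (dirichletWeight_pos n).le (by positivity))
    (fun n _ => div_nonneg (by positivity) (dirichletWeight_pos n).le)
    (fun n _ => by have := (dirichletWeight_pos n).ne'; exact le_of_eq (by field_simp))
  calc X = √X ^ 2 := (Real.sq_sqrt hX0).symm
    _ ≤ _ := pow_le_pow_left₀ hs.le hle 2
    _ ≤ _ := hcs
    _ ≤ (∑ n ∈ Finset.range N, dirichletWeight n * ‖a n‖ ^ 2) * C :=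
      mul_le_mul_of_nonneg_left hm hA
    _ = _ := mul_comm _ _

end Duality

section LogEnergy

variable {ν : Measure ℂ}

lemma aemeasurable_log_energy [SFinite ν] {g : ℂ → ℂ} (hg : AEMeasurable g ν) (r : ℝ) :
    AEMeasurable (fun p : ℂ × ℂ =>
      Real.log (2 / ‖1 - (r : ℂ) * (conj p.1 * p.2)‖) * ‖g p.2‖ * ‖g p.1‖) (ν.prod ν) := by
  have h1 : Measurable fun p : ℂ × ℂ => ‖1 - (r : ℂ) * (conj p.1 * p.2)‖ :=
    Continuous.measurable (by fun_prop)
  have h2 : Measurable fun p : ℂ × ℂ => Real.log (2 / ‖1 - (r : ℂ) * (conj p.1 * p.2)‖) :=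
    Real.measurable_log.comp (h1.const_div 2)
  have hg1 : AEMeasurable (fun p : ℂ × ℂ => g p.1) (ν.prod ν) :=
    hg.comp_quasiMeasurePreserving Measure.quasiMeasurePreserving_fst
  have hg2 : AEMeasurable (fun p : ℂ × ℂ => g p.2) (ν.prod ν) :=
    hg.comp_quasiMeasurePreserving Measure.quasiMeasurePreserving_snd
  exact (h2.aemeasurable.mul hg2.norm).mul hg1.norm

variable [IsFiniteMeasure ν]

lemma lintegral_log_energy_eq {g : ℂ → ℂ} (hg : AEMeasurable g ν) :
    ∫⁻ w, ∫⁻ z, ENNReal.ofReal (Real.log (2 / ‖1 - conj w * z‖) * ‖g z‖ * ‖g w‖) ∂ν ∂ν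
      = ∫⁻ p : ℂ × ℂ, ENNReal.ofReal
          (Real.log (2 / ‖1 - conj p.1 * p.2‖) * ‖g p.2‖ * ‖g p.1‖) ∂ν.prod ν := by
  have h := aemeasurable_log_energy hg 1
  simp only [Complex.ofReal_one, one_mul] at h
  rw [lintegral_prod _ h.ennreal_ofReal]

/-- A bound on the logarithmic energy bounds the conjugate moments. -/
lemma sum_conjMoment_le_of_log_energy (hν : ∀ᵐ z ∂ν, ‖z‖ < 1) {M : ℝ} (hM : 0 ≤ M)
    {g : ℂ → ℂ} (hg : Integrable g ν) (hg2 : Integrable (fun z => ‖g z‖ ^ 2) ν)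
    (hg1 : ∫ z, ‖g z‖ ^ 2 ∂ν ≤ 1)
    (hE : ∫⁻ p : ℂ × ℂ, ENNReal.ofReal
        (Real.log (2 / ‖1 - conj p.1 * p.2‖) * ‖g p.2‖ * ‖g p.1‖) ∂ν.prod ν ≤ ENNReal.ofReal M)
    (N : ℕ) :
    ∑ n ∈ Finset.range N, ‖conjMoment ν g n‖ ^ 2 / dirichletWeight n
      ≤ M + 8 * (ν.real univ + 1) ^ 2 := by
  have hdisk := ae_prod_norm_lt_one hν
  have hLm := aemeasurable_log_energy hg.aemeasurable 1
  simp only [Complex.ofReal_one, one_mul] at hLm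
  have hL0 : 0 ≤ᵐ[ν.prod ν] fun p : ℂ × ℂ =>
      Real.log (2 / ‖1 - conj p.1 * p.2‖) * ‖g p.2‖ * ‖g p.1‖ := by
    filter_upwards [hdisk] with p hp
    have := log_two_div_norm_one_sub_nonneg (norm_conj_mul_lt_one hp.1 hp.2)
    simp only [Pi.zero_apply]
    positivity
  have hLi : Integrable (fun p : ℂ × ℂ =>
      Real.log (2 / ‖1 - conj p.1 * p.2‖) * ‖g p.2‖ * ‖g p.1‖) (ν.prod ν) :=
    ⟨hLm.aestronglyMeasurable, by
      rw [hasFiniteIntegral_iff_ofReal hL0]; exact hE.trans_lt ENNReal.ofReal_lt_top⟩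
  rw [← ofReal_integral_eq_lintegral_ofReal hLi hL0, ENNReal.ofReal_le_ofReal_iff hM] at hE
  have hgg : Integrable (fun p : ℂ × ℂ => ‖g p.1‖ * ‖g p.2‖) (ν.prod ν) :=
    hg.norm.mul_prod hg.norm
  have hggI : ∫ p : ℂ × ℂ, ‖g p.1‖ * ‖g p.2‖ ∂ν.prod ν ≤ (ν.real univ + 1) ^ 2 := by
    rw [integral_prod_mul (fun z => ‖g z‖) (fun z => ‖g z‖), ← sq]
    exact pow_le_pow_left₀ (integral_nonneg fun z => norm_nonneg _)
      (integral_norm_le hg hg2 hg1) 2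
  have key : ∀ r ∈ Ico (0 : ℝ) 1,
      ∑ n ∈ Finset.range N, r ^ n / dirichletWeight n * ‖conjMoment ν g n‖ ^ 2
        ≤ M + 8 * (ν.real univ + 1) ^ 2 := by
    intro r hr
    have hs := Complex.hasSum_re (hasSum_energy hν hg hr).2
    simp only [Complex.ofReal_re] at hs
    have h1 := sum_le_hasSum (Finset.range N)
      (fun n _ => mul_nonneg (div_nonneg (pow_nonneg hr.1 n) (dirichletWeight_pos n).le)
        (by positivity)) hs
    refine h1.trans ((Complex.re_le_norm _).trans ?_)
    have h2 := norm_integral_le_of_norm_le (hLi.add (hgg.const_mul 8))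
      (f := fun p : ℂ × ℂ => dirichletKernel (r * (conj p.1 * p.2)) * (g p.1 * conj (g p.2)))
      (by
        filter_upwards [hdisk] with p hp
        rw [norm_mul, norm_mul, RCLike.norm_conj]
        refine (mul_le_mul_of_nonneg_right
          (norm_dirichletKernel_le hr (norm_conj_mul_lt_one hp.1 hp.2))
          (by positivity)).trans_eq ?_
        simp only [Pi.add_apply]
        ring)
    refine h2.trans ?_
    simp only [Pi.add_apply]
    rw [integral_add hLi (hgg.const_mul 8), integral_const_mul]
    linarith
  have hc : Tendsto
      (fun r : ℝ => ∑ n ∈ Finset.range N, r ^ n / dirichletWeight n * ‖conjMoment ν g n‖ ^ 2)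
      (𝓝[<] 1)
      (𝓝 (∑ n ∈ Finset.range N, 1 ^ n / dirichletWeight n * ‖conjMoment ν g n‖ ^ 2)) :=
    (Continuous.tendsto (by fun_prop) 1).mono_left nhdsWithin_le_nhds
  have := le_of_tendsto hc (by
    filter_upwards [Ioo_mem_nhdsLT (zero_lt_one' ℝ)] with r hr using key r ⟨hr.1.le, hr.2⟩)
  refine le_of_eq_of_le (Finset.sum_congr rfl fun n _ => ?_) this
  rw [one_pow]; ring

/-- A bound on the moments of `|g|` bounds the logarithmic energy of `g`. -/
lemma log_energy_le_of_sum_conjMoment (hν : ∀ᵐ z ∂ν, ‖z‖ < 1) {C : ℝ}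
    {g : ℂ → ℂ} (hg : Integrable g ν)
    (hmom : ∀ N, ∑ n ∈ Finset.range N,
      ‖conjMoment ν (fun z => (‖g z‖ : ℂ)) n‖ ^ 2 / dirichletWeight n ≤ C) :
    ∫⁻ p : ℂ × ℂ, ENNReal.ofReal
        (Real.log (2 / ‖1 - conj p.1 * p.2‖) * ‖g p.2‖ * ‖g p.1‖) ∂ν.prod ν
      ≤ ENNReal.ofReal C := by
  have hdisk := ae_prod_norm_lt_one hν
  have key : ∀ r ∈ Ico (0 : ℝ) 1,
      ∫⁻ p : ℂ × ℂ, ENNReal.ofReal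
        (Real.log (2 / ‖1 - (r : ℂ) * (conj p.1 * p.2)‖) * ‖g p.2‖ * ‖g p.1‖) ∂ν.prod ν
      ≤ ENNReal.ofReal C := by
    intro r hr
    obtain ⟨hi, hs⟩ := hasSum_energy hν (h := fun z => (‖g z‖ : ℂ)) hg.norm.ofReal hr
    have hs := Complex.hasSum_re hs
    simp only [Complex.ofReal_re] at hs
    have h1 := le_of_tendsto' hs.tendsto_sum_nat (b := C) fun N => by
      refine le_trans (Finset.sum_le_sum fun n _ => ?_) (hmom N)
      rw [div_mul_eq_mul_div]
      exact div_le_div_of_nonneg_right (mul_le_of_le_one_left (by positivity)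
        (pow_le_one₀ hr.1 hr.2.le)) (dirichletWeight_pos n).le
    have hpt : ∀ᵐ p ∂ν.prod ν,
        0 ≤ Real.log (2 / ‖1 - (r : ℂ) * (conj p.1 * p.2)‖) * ‖g p.2‖ * ‖g p.1‖ ∧
        Real.log (2 / ‖1 - (r : ℂ) * (conj p.1 * p.2)‖) * ‖g p.2‖ * ‖g p.1‖
          ≤ (dirichletKernel (r * (conj p.1 * p.2)) * ((‖g p.1‖ : ℂ) * conj (‖g p.2‖ : ℂ))).re := by
      filter_upwards [hdisk] with p hp
      have hζ := norm_ofReal_mul_lt_one hr (norm_conj_mul_lt_one hp.1 hp.2)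
      have h2 := log_two_div_norm_one_sub_nonneg hζ
      refine ⟨by positivity, ?_⟩
      rw [Complex.conj_ofReal, ← Complex.ofReal_mul, Complex.re_mul_ofReal, dirichletKernel_re,
        log_two_div_norm_one_sub hζ, mul_assoc, mul_comm ‖g p.2‖]
      have := Real.log_two_lt_d9
      exact mul_le_mul_of_nonneg_right (by linarith) (by positivity)
    calc _ ≤ ∫⁻ p : ℂ × ℂ, ENNReal.ofReal (dirichletKernel (r * (conj p.1 * p.2)) *
          ((‖g p.1‖ : ℂ) * conj (‖g p.2‖ : ℂ))).re ∂ν.prod ν :=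
        lintegral_mono_ae (hpt.mono fun p hp => ENNReal.ofReal_le_ofReal hp.2)
      _ = ENNReal.ofReal (∫ p : ℂ × ℂ, (dirichletKernel (r * (conj p.1 * p.2)) *
          ((‖g p.1‖ : ℂ) * conj (‖g p.2‖ : ℂ))).re ∂ν.prod ν) :=
        (ofReal_integral_eq_lintegral_ofReal hi.re
          (hpt.mono fun p hp => hp.1.trans hp.2)).symm
      _ ≤ _ := by
        refine ENNReal.ofReal_le_ofReal (le_of_eq_of_le ?_ h1)
        exact integral_re hi
  set r : ℕ → ℝ := fun j => (j : ℝ) / (j + 1) with hr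
  have hr1 : ∀ j, r j ∈ Ico (0 : ℝ) 1 := fun j =>
    ⟨by positivity, (div_lt_one (by positivity)).mpr (by linarith)⟩
  have hrt : Tendsto r atTop (𝓝 1) := tendsto_natCast_div_add_atTop (1 : ℝ)
  have hae : ∀ᵐ p ∂ν.prod ν,
      ENNReal.ofReal (Real.log (2 / ‖1 - conj p.1 * p.2‖) * ‖g p.2‖ * ‖g p.1‖)
        = liminf (fun j => ENNReal.ofReal
          (Real.log (2 / ‖1 - (r j : ℂ) * (conj p.1 * p.2)‖) * ‖g p.2‖ * ‖g p.1‖)) atTop := by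
    filter_upwards [hdisk] with p hp
    refine (Tendsto.liminf_eq (ENNReal.tendsto_ofReal ?_)).symm
    refine ((Tendsto.log ?_ ?_).mul_const _).mul_const _
    · have hne := (norm_one_sub_pos (norm_conj_mul_lt_one hp.1 hp.2)).ne'
      refine Tendsto.div tendsto_const_nhds ?_ hne
      have h1 : Tendsto (fun j => ‖1 - (r j : ℂ) * (conj p.1 * p.2)‖) atTop
          (𝓝 ‖1 - ((1 : ℝ) : ℂ) * (conj p.1 * p.2)‖) := by
        have hc : Continuous fun x : ℝ => ‖1 - (x : ℂ) * (conj p.1 * p.2)‖ := by fun_prop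
        exact (hc.tendsto 1).comp hrt
      simpa using h1
    · exact (div_pos two_pos (norm_one_sub_pos (norm_conj_mul_lt_one hp.1 hp.2))).ne'
  rw [lintegral_congr_ae hae]
  refine (lintegral_liminf_le' fun j =>
    (aemeasurable_log_energy hg.aemeasurable (r j)).ennreal_ofReal).trans ?_
  exact liminf_le_of_frequently_le' (Frequently.of_forall fun j => key (r j) (hr1 j))

end LogEnergy

/-- A finite Borel measure `μ` on the unit disk is a Carleson measure for the Dirichlet
space iff the bilinear form
`∬ log(2/|1 - w̄z|) |g(z)| |g(w)| dμ(z) dμ(w)` is uniformly bounded over the unit ball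
of `L²(μ)`. -/
theorem statement5 (μ : Measure ℂ) [IsFiniteMeasure μ]
    (hμsupp : μ (Metric.ball (0:ℂ) 1)ᶜ = 0) :
    IsCarlesonDirichlet μ ↔
      ∃ M : ℝ, ∀ g : ℂ → ℂ, AEMeasurable g (μ.restrict (Metric.ball (0:ℂ) 1)) →
        (∫⁻ z in Metric.ball (0:ℂ) 1, ENNReal.ofReal (‖g z‖ ^ 2) ∂μ) ≤ 1 →
        (∫⁻ w in Metric.ball (0:ℂ) 1, ∫⁻ z in Metric.ball (0:ℂ) 1,
            ENNReal.ofReal (Real.log (2 / ‖1 - (starRingEnd ℂ) w * z‖) * ‖g z‖ * ‖g w‖)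
              ∂μ ∂μ) ≤ ENNReal.ofReal M := by
  set ν := μ.restrict (ball (0 : ℂ) 1) with hνdef
  have hν : ∀ᵐ z ∂ν, ‖z‖ < 1 :=
    (ae_restrict_iff' measurableSet_ball).mpr (ae_of_all _ fun z hz => by simpa using hz)
  have hnn : ∀ f, 0 ≤ dirichletNormSq f := fun f =>
    add_nonneg (by positivity) (mul_nonneg (by positivity)
      (integral_nonneg fun z => by positivity))
  constructor
  · rintro ⟨C, hC⟩
    refine ⟨max C 1, fun g hg hg1 => ?_⟩
    obtain ⟨hgi, hg2, hgle⟩ := ofReal_norm_sq_integrable hg hg1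
    rw [lintegral_log_energy_eq hg]
    refine log_energy_le_of_sum_conjMoment hν hgi fun N => ?_
    refine le_trans (Finset.sum_le_sum_of_subset_of_nonneg (Finset.range_mono N.le_succ)
      fun n _ _ => div_nonneg (by positivity) (dirichletWeight_pos n).le)
      (sum_conjMoment_le_of_carleson hν (C := max C 1) (lt_max_of_lt_right one_pos)
        (fun f hf => (hC f hf).trans (ENNReal.ofReal_le_ofReal
          (mul_le_mul_of_nonneg_right (le_max_left _ _) (hnn f))))
        hgi.norm.ofReal (by simpa using hg2) (by simpa using hgle) N)
  · rintro ⟨M, hM⟩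
    set C := max M 0 + 8 * (ν.real univ + 1) ^ 2 with hCdef
    have hC0 : 0 ≤ C := add_nonneg (le_max_right _ _) (by positivity)
    have hmom : ∀ h : ℂ → ℂ, Integrable h ν → Integrable (fun z => ‖h z‖ ^ 2) ν →
        ∫ z, ‖h z‖ ^ 2 ∂ν ≤ 1 → ∀ N,
          ∑ n ∈ Finset.range N, ‖conjMoment ν h n‖ ^ 2 / dirichletWeight n ≤ C := by
      intro h hh hh2 hh1
      refine sum_conjMoment_le_of_log_energy hν (le_max_right M 0) hh hh2 hh1 ?_
      rw [← lintegral_log_energy_eq hh.aemeasurable]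
      refine (hM h hh.aemeasurable ?_).trans (ENNReal.ofReal_le_ofReal (le_max_left _ _))
      rw [← ofReal_integral_eq_lintegral_ofReal hh2 (ae_of_all _ fun z => by positivity)]
      exact ENNReal.ofReal_le_one.mpr hh1
    refine ⟨C, fun f hf => ?_⟩
    obtain ⟨a, ha, hab⟩ := hf.exists_hasSum
    have hae : ∀ᵐ z ∂ν, ENNReal.ofReal (‖f z‖ ^ 2) = liminf (fun N => ENNReal.ofReal
        (‖∑ n ∈ Finset.range (N + 1), a n * z ^ n‖ ^ 2)) atTop := by
      filter_upwards [hν] with z hz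
      refine (Tendsto.liminf_eq (ENNReal.tendsto_ofReal ?_)).symm
      exact (((tendsto_add_atTop_iff_nat 1).mpr
        (ha z (by simpa using hz)).tendsto_sum_nat).norm).pow 2
    rw [lintegral_congr_ae hae]
    refine (lintegral_liminf_le fun N =>
      (Continuous.measurable (by fun_prop)).ennreal_ofReal).trans ?_
    refine liminf_le_of_frequently_le' (Frequently.of_forall fun N => ?_)
    rw [← ofReal_integral_eq_lintegral_ofReal
      (integrable_of_continuous hν (by fun_prop)) (ae_of_all _ fun z => by positivity)]
    exact ENNReal.ofReal_le_ofReal ((integral_norm_sq_polynomial_le hν hC0 hmom a (N + 1)).trans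
      (mul_le_mul_of_nonneg_left (hab N) hC0))

end
end

section
/- Let μ be a finite positive Borel measure on the open unit disk 𝔻 such that sup over w ∈ 𝔻 of ∫_𝔻 log(2/|1 − w̄z|) dμ(z) is finite. Then μ is a Carleson measure for the Dirichlet space 𝒟. -/
open MeasureTheory Metric Complex Filter Set

noncomputable section

/-- Integrability is preserved by passing to polar coordinates. -/
theorem integrableOn_smul_comp_polarCoord_symm {h : ℂ → ℂ} (hm : Measurable h)
    (hi : Integrable h) :
    IntegrableOn (fun p : ℝ × ℝ => p.1 • h (Complex.polarCoord.symm p)) polarCoord.target := by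
  have hs : Measurable fun p : ℝ × ℝ => Complex.polarCoord.symm p := by
    simp only [Complex.polarCoord_symm_apply]
    fun_prop
  refine ⟨(measurable_fst.smul (hm.comp hs)).aestronglyMeasurable, ?_⟩
  have h1 := Complex.lintegral_comp_polarCoord_symm fun z => ‖h z‖ₑ
  have h2 := hi.2
  rw [HasFiniteIntegral, ← h1] at h2
  rw [HasFiniteIntegral]
  refine lt_of_le_of_lt (le_of_eq ?_) h2
  refine setLIntegral_congr_fun polarCoord.open_target.measurableSet fun p hp => ?_
  have hp1 : 0 < p.1 := hp.1
  simp only [enorm_smul, Real.enorm_eq_ofReal hp1.le, smul_eq_mul]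

theorem integral_Ioo_circle_eq_circleAverage (h : ℂ → ℂ) (r : ℝ) :
    ∫ θ in Ioo (-Real.pi) Real.pi, h (r * (Real.cos θ + Real.sin θ * I)) =
      (2 * Real.pi) • Real.circleAverage h 0 r := by
  rw [Real.circleAverage_eq_integral_add (-Real.pi), smul_smul, mul_inv_cancel₀ (by positivity),
    one_smul, intervalIntegral.integral_comp_add_right (fun θ => h (circleMap 0 r θ)),
    intervalIntegral.integral_of_le (by linarith [Real.pi_pos]), ← integral_Ioc_eq_integral_Ioo]
  have : 2 * Real.pi + -Real.pi = Real.pi := by ring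
  rw [this, zero_add]
  refine integral_congr_ae (.of_forall fun θ => ?_)
  simp [circleMap, Complex.exp_mul_I]

theorem integral_ball_eq_integral_circleAverage {h : ℂ → ℂ} (hm : Measurable h)
    (hi : IntegrableOn h (ball 0 1)) :
    ∫ z in ball (0 : ℂ) 1, h z =
      ∫ r in (0 : ℝ)..1, (2 * Real.pi * r) • Real.circleAverage h 0 r := by
  have hI := integrableOn_smul_comp_polarCoord_symm (hm.indicator measurableSet_ball)
    ((integrable_indicator_iff (measurableSet_ball (x := (0 : ℂ)) (ε := 1))).2 hi)
  rw [← integral_indicator measurableSet_ball, ← Complex.integral_comp_polarCoord_symm]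
  rw [polarCoord_target] at hI ⊢
  rw [Measure.volume_eq_prod] at hI ⊢
  rw [setIntegral_prod _ hI, intervalIntegral.integral_of_le zero_le_one,
    integral_Ioc_eq_integral_Ioo, ← Ioi_inter_Iio (a := (0 : ℝ)), ← setIntegral_indicator measurableSet_Iio]
  refine setIntegral_congr_fun measurableSet_Ioi fun r hr => ?_
  have hr : 0 < r := hr
  have hn (θ : ℝ) : ‖Complex.polarCoord.symm (r, θ)‖ = r := by
    rw [norm_polarCoord_symm, abs_of_pos hr]
  by_cases h1 : r < 1
  · have hmem (θ : ℝ) : Complex.polarCoord.symm (r, θ) ∈ ball (0 : ℂ) 1 := by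
      rw [mem_ball_zero_iff, hn]; exact h1
    simp only [indicator_of_mem (hmem _), indicator_of_mem (show r ∈ Iio 1 from h1)]
    rw [integral_smul]
    simp only [Complex.polarCoord_symm_apply]
    rw [integral_Ioo_circle_eq_circleAverage, smul_smul]
    congr 1; ring
  · have hmem (θ : ℝ) : Complex.polarCoord.symm (r, θ) ∉ ball (0 : ℂ) 1 := by
      rw [mem_ball_zero_iff, hn]; exact h1
    simp only [indicator_of_notMem (hmem _), indicator_of_notMem (show r ∉ Iio 1 from h1),
      smul_zero, integral_zero]

/-- The conjugate of the `z`-derivative of the Dirichlet kernel `log (1 / (1 - w̄ z))`. -/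
def dirichletKernelDeriv (w z : ℂ) : ℂ := w / (1 - w * (starRingEnd ℂ) z)

@[fun_prop]
theorem Measurable.dirichletKernelDeriv {α : Type*} [MeasurableSpace α] {u v : α → ℂ}
    (hu : Measurable u) (hv : Measurable v) :
    Measurable fun x => dirichletKernelDeriv (u x) (v x) := by
  unfold _root_.dirichletKernelDeriv
  fun_prop

theorem norm_dirichletKernelDeriv_le {r : ℝ} (hr : r < 1) {w z : ℂ} (hw : ‖w‖ ≤ r)
    (hz : ‖z‖ ≤ 1) : ‖dirichletKernelDeriv w z‖ ≤ 1 / (1 - r) := by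
  have h1 : ‖w * (starRingEnd ℂ) z‖ ≤ r := by
    rw [norm_mul, RCLike.norm_conj]
    nlinarith [norm_nonneg w, norm_nonneg z]
  have h2 : 1 - r ≤ ‖1 - w * (starRingEnd ℂ) z‖ := by
    have := norm_sub_norm_le (1 : ℂ) (w * (starRingEnd ℂ) z)
    rw [norm_one] at this
    linarith
  unfold dirichletKernelDeriv
  rw [norm_div]
  have := sub_pos.2 hr
  gcongr
  linarith

theorem circleAverage_deriv_mul_dirichletKernelDeriv {f : ℂ → ℂ}
    (hf : DifferentiableOn ℂ f (ball 0 1)) {w : ℂ} (hw : ‖w‖ < 1) {r : ℝ} (hr : 0 < r)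
    (hr1 : r < 1) :
    Real.circleAverage (fun z => deriv f z * dirichletKernelDeriv w z) 0 r =
      w * deriv f (r ^ 2 * w) := by
  have hd : DifferentiableOn ℂ (deriv f) (ball 0 1) := hf.deriv isOpen_ball
  have hcl : DiffContOnCl ℂ (deriv f) (ball 0 r) := by
    apply DifferentiableOn.diffContOnCl
    rw [closure_ball _ hr.ne']
    exact hd.mono (closedBall_subset_ball hr1)
  have hmem : (r ^ 2 * w : ℂ) ∈ ball (0 : ℂ) r := by
    rw [mem_ball_zero_iff, norm_mul, norm_pow, Complex.norm_real, Real.norm_of_nonneg hr.le]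
    have : r * ‖w‖ < 1 := by nlinarith [norm_nonneg w]
    nlinarith
  rw [Real.circleAverage_eq_circleIntegral hr.ne']
  have key : (∮ z in C(0, r), (z - 0)⁻¹ • (deriv f z * dirichletKernelDeriv w z)) =
      ∮ z in C(0, r), w • ((z - r ^ 2 * w)⁻¹ • deriv f z) := by
    refine circleIntegral.integral_congr hr.le fun z hz => ?_
    have hzn : ‖z‖ = r := by simpa using hz
    have hz0 : z ≠ 0 := by rw [← norm_pos_iff, hzn]; exact hr
    have hzc : z * (starRingEnd ℂ) z = r ^ 2 := by
      rw [Complex.mul_conj, Complex.normSq_eq_norm_sq, hzn]; push_cast; rfl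
    have h3 : z - r ^ 2 * w = z * (1 - w * (starRingEnd ℂ) z) := by rw [← hzc]; ring
    simp only [sub_zero, smul_eq_mul, h3, dirichletKernelDeriv, mul_inv, div_eq_mul_inv]
    ring
  rw [key, circleIntegral.integral_smul, hcl.circleIntegral_sub_inv_smul hmem]
  simp only [smul_eq_mul]
  have : (2 * Real.pi * I : ℂ) ≠ 0 := two_pi_I_ne_zero
  field_simp

/-- The reproducing formula `f w - f 0 = ⟨f, log (1 / (1 - w̄ z))⟩` in the Dirichlet space. -/
theorem integral_deriv_mul_dirichletKernelDeriv {f : ℂ → ℂ}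
    (hf : DifferentiableOn ℂ f (ball 0 1)) (hfi : IntegrableOn (deriv f) (ball 0 1))
    {w : ℂ} (hw : ‖w‖ < 1) :
    ∫ z in ball (0 : ℂ) 1, deriv f z * dirichletKernelDeriv w z = Real.pi * (f w - f 0) := by
  have hmeas : Measurable fun z => deriv f z * dirichletKernelDeriv w z :=
    (measurable_deriv f).mul (measurable_const.dirichletKernelDeriv measurable_id)
  have hint : IntegrableOn (fun z => deriv f z * dirichletKernelDeriv w z) (ball 0 1) := by
    refine hfi.mul_bdd (c := 1 / (1 - ‖w‖))
      (measurable_const.dirichletKernelDeriv measurable_id).aestronglyMeasurable ?_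
    refine (ae_restrict_iff' measurableSet_ball).2 (.of_forall fun z hz => ?_)
    exact norm_dirichletKernelDeriv_le hw le_rfl (mem_ball_zero_iff.1 hz).le
  have hd : DifferentiableOn ℂ (deriv f) (ball 0 1) := hf.deriv isOpen_ball
  have hmem {r : ℝ} (hr : r ∈ Icc (0 : ℝ) 1) : (r ^ 2 * w : ℂ) ∈ ball (0 : ℂ) 1 := by
    rw [mem_ball_zero_iff, norm_mul, norm_pow, Complex.norm_real, Real.norm_of_nonneg hr.1]
    have : r ^ 2 ≤ 1 := pow_le_one₀ hr.1 hr.2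
    nlinarith [norm_nonneg w]
  rw [integral_ball_eq_integral_circleAverage hmeas hint]
  have hcongr : ∫ r in (0 : ℝ)..1, (2 * Real.pi * r) •
        Real.circleAverage (fun z => deriv f z * dirichletKernelDeriv w z) 0 r =
      ∫ r in (0 : ℝ)..1, (Real.pi : ℂ) * (deriv f (r ^ 2 * w) * (2 * r * w)) := by
    rw [intervalIntegral.integral_of_le zero_le_one, intervalIntegral.integral_of_le zero_le_one,
      integral_Ioc_eq_integral_Ioo, integral_Ioc_eq_integral_Ioo]
    refine setIntegral_congr_fun measurableSet_Ioo fun r hr => ?_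
    rw [circleAverage_deriv_mul_dirichletKernelDeriv hf hw hr.1 hr.2, Complex.real_smul]
    push_cast
    ring
  rw [hcongr, intervalIntegral.integral_const_mul,
    intervalIntegral.integral_eq_sub_of_hasDerivAt (f := fun r : ℝ => f (r ^ 2 * w))]
  · simp
  · intro r hr
    rw [uIcc_of_le zero_le_one] at hr
    have h1 : HasDerivAt (fun r : ℝ => (r ^ 2 * w : ℂ)) (2 * r * w) r := by
      have := ((Complex.ofRealCLM.hasDerivAt (x := r)).pow 2).mul_const w
      simpa using this
    exact ((hf.differentiableAt (isOpen_ball.mem_nhds (hmem hr))).hasDerivAt).comp r h1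
  · refine ContinuousOn.intervalIntegrable ?_
    rw [uIcc_of_le zero_le_one]
    refine ContinuousOn.mul (hd.continuousOn.comp (by fun_prop) fun r hr => hmem hr) (by fun_prop)

/-- A positive symmetric majorant of the Dirichlet kernel. -/
def logKernel (w u : ℂ) : ℝ :=
  Real.log (2 / ‖1 - (starRingEnd ℂ) w * u‖) + (Real.log 2 + Real.pi)

theorem logKernel_comm (w u : ℂ) : logKernel w u = logKernel u w := by
  have : ‖1 - (starRingEnd ℂ) w * u‖ = ‖1 - (starRingEnd ℂ) u * w‖ := by
    rw [← RCLike.norm_conj]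
    simp [mul_comm]
  unfold logKernel
  rw [this]

@[fun_prop]
theorem Measurable.logKernel {α : Type*} [MeasurableSpace α] {u v : α → ℂ}
    (hu : Measurable u) (hv : Measurable v) :
    Measurable fun x => logKernel (u x) (v x) := by
  unfold _root_.logKernel
  fun_prop

theorem norm_conj_mul_lt_one_s6 {w u : ℂ} (hw : ‖w‖ < 1) (hu : ‖u‖ < 1) :
    ‖(starRingEnd ℂ) w * u‖ < 1 := by
  rw [norm_mul, RCLike.norm_conj]
  nlinarith [norm_nonneg w, norm_nonneg u]

theorem norm_one_sub_mem_Ioo {x : ℂ} (hx : ‖x‖ < 1) : ‖1 - x‖ ∈ Ioo (0 : ℝ) 2 := by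
  have h1 := norm_sub_norm_le (1 : ℂ) x
  have h2 := norm_sub_le (1 : ℂ) x
  rw [norm_one] at h1 h2
  constructor <;> linarith

theorem log_two_div_nonneg {w u : ℂ} (hw : ‖w‖ < 1) (hu : ‖u‖ < 1) :
    0 ≤ Real.log (2 / ‖1 - (starRingEnd ℂ) w * u‖) := by
  obtain ⟨h1, h2⟩ := norm_one_sub_mem_Ioo (norm_conj_mul_lt_one_s6 hw hu)
  exact Real.log_nonneg ((one_le_div h1).2 h2.le)

theorem logKernel_nonneg {w u : ℂ} (hw : ‖w‖ < 1) (hu : ‖u‖ < 1) : 0 ≤ logKernel w u := by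
  have := log_two_div_nonneg hw hu
  have := Real.log_nonneg one_le_two
  have := Real.pi_pos
  unfold logKernel
  linarith

theorem logKernel_le {r : ℝ} (hr : r < 1) {w u : ℂ} (hw : ‖w‖ < r) (hu : ‖u‖ < r) :
    logKernel w u ≤ Real.log (2 / (1 - r)) + (Real.log 2 + Real.pi) := by
  have h1 := norm_sub_norm_le (1 : ℂ) ((starRingEnd ℂ) w * u)
  have h2 : ‖(starRingEnd ℂ) w * u‖ ≤ r := by
    rw [norm_mul, RCLike.norm_conj]
    nlinarith [norm_nonneg w, norm_nonneg u]
  rw [norm_one] at h1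
  have h3 := sub_pos.2 hr
  have h4 : 1 - r ≤ ‖1 - (starRingEnd ℂ) w * u‖ := by linarith
  unfold logKernel
  have : 0 < 2 / ‖1 - (starRingEnd ℂ) w * u‖ := div_pos two_pos (h3.trans_le h4)
  gcongr

theorem norm_log_one_sub_le_logKernel {w u : ℂ} (hw : ‖w‖ < 1) (hu : ‖u‖ < 1) :
    ‖Complex.log (1 - (starRingEnd ℂ) w * u)‖ ≤ logKernel w u := by
  obtain ⟨h1, h2⟩ := norm_one_sub_mem_Ioo (norm_conj_mul_lt_one_s6 hw hu)
  refine (Complex.norm_le_abs_re_add_abs_im _).trans ?_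
  have him := Complex.abs_arg_le_pi (1 - (starRingEnd ℂ) w * u)
  rw [Complex.log_re, Complex.log_im, logKernel, Real.log_div two_ne_zero h1.ne']
  have h3 := Real.log_le_log h1 h2.le
  have h4 := Real.log_nonneg one_le_two
  have : |Real.log ‖1 - (starRingEnd ℂ) w * u‖| ≤
      2 * Real.log 2 - Real.log ‖1 - (starRingEnd ℂ) w * u‖ := by
    rw [abs_le]; constructor <;> linarith
  linarith

instance : IsFiniteMeasure ((volume : Measure ℂ).restrict (ball 0 1)) :=
  ⟨by simp⟩

/-- The Gram formula for the derivatives of the Dirichlet kernels. -/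
theorem integral_conj_dirichletKernelDeriv_mul {w u : ℂ} (hw : ‖w‖ < 1) (hu : ‖u‖ < 1) :
    ∫ z in ball (0 : ℂ) 1, (starRingEnd ℂ) (dirichletKernelDeriv u z) * dirichletKernelDeriv w z =
      -(Real.pi * Complex.log (1 - (starRingEnd ℂ) u * w)) := by
  have hd {z : ℂ} (hz : z ∈ ball (0 : ℂ) 1) :
      HasDerivAt (fun z => -Complex.log (1 - (starRingEnd ℂ) u * z))
        ((starRingEnd ℂ) (dirichletKernelDeriv u z)) z := by
    have hx := norm_conj_mul_lt_one_s6 hu (mem_ball_zero_iff.1 hz)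
    have h1 : HasDerivAt (fun z => 1 - (starRingEnd ℂ) u * z) (-(starRingEnd ℂ) u) z := by
      simpa using ((hasDerivAt_id z).const_mul ((starRingEnd ℂ) u)).const_sub 1
    have hs : 1 - (starRingEnd ℂ) u * z ∈ slitPlane := by
      refine Or.inl ?_
      have := (Complex.re_le_norm ((starRingEnd ℂ) u * z)).trans_lt hx
      simp only [Complex.sub_re, Complex.one_re]
      linarith
    refine (h1.clog hs).neg.congr_deriv ?_
    simp [dirichletKernelDeriv, neg_div]
  have hc : EqOn (deriv fun z => -Complex.log (1 - (starRingEnd ℂ) u * z))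
      (fun z => (starRingEnd ℂ) (dirichletKernelDeriv u z)) (ball 0 1) := fun z hz => (hd hz).deriv
  have hi : IntegrableOn (fun z => (starRingEnd ℂ) (dirichletKernelDeriv u z)) (ball 0 1) := by
    refine Integrable.of_bound (by fun_prop) (1 / (1 - ‖u‖)) ?_
    refine (ae_restrict_iff' measurableSet_ball).2 (.of_forall fun z hz => ?_)
    rw [RCLike.norm_conj]
    exact norm_dirichletKernelDeriv_le hu le_rfl (mem_ball_zero_iff.1 hz).le
  have h := integral_deriv_mul_dirichletKernelDeriv
    (f := fun z => -Complex.log (1 - (starRingEnd ℂ) u * z))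
    (fun z hz => (hd hz).differentiableAt.differentiableWithinAt)
    (hi.congr_fun hc.symm measurableSet_ball) hw
  rw [setIntegral_congr_fun measurableSet_ball
    (fun z hz => congrArg (· * dirichletKernelDeriv w z) (hc hz))] at h
  exact h.trans (by simp)

/-- Schur's test for the symmetric kernel `logKernel`. -/
theorem integrable_and_integral_logKernel_le {m : Measure ℂ} [IsFiniteMeasure m] {r C : ℝ}
    (hr : r < 1) (hm : ∀ᵐ w ∂m, ‖w‖ < r) {q : ℂ → ℝ} (hq : AEStronglyMeasurable q m)
    {B : ℝ} (hB : ∀ᵐ w ∂m, ‖q w‖ ≤ B) (hq0 : ∀ w, 0 ≤ q w)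
    (hC : ∀ w : ℂ, ‖w‖ < r → ∫ u, logKernel w u ∂m ≤ C) :
    Integrable (fun p : ℂ × ℂ => (q p.1 + q p.2) * logKernel p.1 p.2) (m.prod m) ∧
      ∫ p : ℂ × ℂ, (q p.1 + q p.2) * logKernel p.1 p.2 ∂(m.prod m) ≤ 2 * (C * ∫ w, q w ∂m) := by
  have hqi : Integrable q m := Integrable.of_bound hq B hB
  have hm1 : ∀ᵐ p : ℂ × ℂ ∂(m.prod m), ‖p.1‖ < r := Measure.quasiMeasurePreserving_fst.ae hm
  have hm2 : ∀ᵐ p : ℂ × ℂ ∂(m.prod m), ‖p.2‖ < r := Measure.quasiMeasurePreserving_snd.ae hm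
  have hL : ∀ᵐ p : ℂ × ℂ ∂(m.prod m),
      ‖logKernel p.1 p.2‖ ≤ Real.log (2 / (1 - r)) + (Real.log 2 + Real.pi) := by
    filter_upwards [hm1, hm2] with p h1 h2
    rw [Real.norm_of_nonneg (logKernel_nonneg (h1.trans hr) (h2.trans hr))]
    exact logKernel_le hr h1 h2
  have hLm : AEStronglyMeasurable (fun p : ℂ × ℂ => logKernel p.1 p.2) (m.prod m) :=
    (measurable_fst.logKernel measurable_snd).aestronglyMeasurable
  have hi1 : Integrable (fun p : ℂ × ℂ => q p.1 * logKernel p.1 p.2) (m.prod m) :=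
    (hqi.comp_fst m).mul_bdd hLm hL
  have hi2 : Integrable (fun p : ℂ × ℂ => q p.2 * logKernel p.1 p.2) (m.prod m) :=
    (hqi.comp_snd m).mul_bdd hLm hL
  have e1 : ∫ p : ℂ × ℂ, q p.1 * logKernel p.1 p.2 ∂(m.prod m) ≤ C * ∫ w, q w ∂m := by
    rw [integral_prod _ hi1, ← integral_const_mul]
    refine integral_mono_ae hi1.integral_prod_left (hqi.const_mul C) ?_
    filter_upwards [hm] with w hw
    simp only [integral_const_mul]
    rw [mul_comm]
    exact mul_le_mul_of_nonneg_right (hC w hw) (hq0 w)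
  have e2 : ∫ p : ℂ × ℂ, q p.2 * logKernel p.1 p.2 ∂(m.prod m) ≤ C * ∫ w, q w ∂m := by
    rw [← integral_prod_swap]
    simpa only [Prod.fst_swap, Prod.snd_swap, logKernel_comm] using e1
  simp only [add_mul]
  refine ⟨hi1.add hi2, ?_⟩
  rw [integral_add hi1 hi2]
  linarith

/-- The derivative (up to conjugation) of the synthesis operator of the Dirichlet kernels. -/
def dirichletSynthesis (m : Measure ℂ) (g : ℂ → ℂ) (z : ℂ) : ℂ :=
  ∫ w, (starRingEnd ℂ) (g w) * dirichletKernelDeriv w z ∂m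

theorem ae_norm_lt_one_volume_ball : ∀ᵐ z ∂(volume : Measure ℂ).restrict (ball 0 1), ‖z‖ < 1 :=
  (ae_restrict_iff' measurableSet_ball).2 (.of_forall fun _ hz => mem_ball_zero_iff.1 hz)

theorem integrable_dirichletSynthesis_and_le {m : Measure ℂ} [IsFiniteMeasure m] {r C : ℝ}
    (hr : r < 1) (hm : ∀ᵐ w ∂m, ‖w‖ < r) {g : ℂ → ℂ} (hg : AEStronglyMeasurable g m)
    {B : ℝ} (hB : ∀ᵐ w ∂m, ‖g w‖ ≤ B)
    (hC : ∀ w : ℂ, ‖w‖ < r → ∫ u, logKernel w u ∂m ≤ C) :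
    IntegrableOn (fun z => ‖dirichletSynthesis m g z‖ ^ 2) (ball 0 1) ∧
      ∫ z in ball (0 : ℂ) 1, ‖dirichletSynthesis m g z‖ ^ 2 ≤
        Real.pi * (C * ∫ w, ‖g w‖ ^ 2 ∂m) := by
  set ν := (volume : Measure ℂ).restrict (ball 0 1) with hν
  set φ : ℂ → ℂ → ℂ := fun w z => (starRingEnd ℂ) (g w) * dirichletKernelDeriv w z with hφ
  have hm1 : ∀ᵐ p : ℂ × ℂ ∂(m.prod m), ‖p.1‖ < r := Measure.quasiMeasurePreserving_fst.ae hm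
  have hm2 : ∀ᵐ p : ℂ × ℂ ∂(m.prod m), ‖p.2‖ < r := Measure.quasiMeasurePreserving_snd.ae hm
  have hgc : AEStronglyMeasurable (fun w => (starRingEnd ℂ) (g w)) m :=
    Complex.continuous_conj.comp_aestronglyMeasurable hg
  have hsq (z : ℂ) : ((‖dirichletSynthesis m g z‖ ^ 2 : ℝ) : ℂ) =
      ∫ p : ℂ × ℂ, φ p.1 z * (starRingEnd ℂ) (φ p.2 z) ∂(m.prod m) := by
    rw [integral_prod_mul (fun w => φ w z) (fun w => (starRingEnd ℂ) (φ w z)), integral_conj,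
      ← Complex.normSq_eq_norm_sq, ← Complex.mul_conj]
    rfl
  have hint : Integrable (Function.uncurry fun (z : ℂ) (p : ℂ × ℂ) =>
      φ p.1 z * (starRingEnd ℂ) (φ p.2 z)) (ν.prod (m.prod m)) := by
    refine Integrable.of_bound ?_ ((B * (1 / (1 - r))) * (B * (1 / (1 - r)))) ?_
    · have h1 : AEStronglyMeasurable (fun x : ℂ × ℂ × ℂ => (starRingEnd ℂ) (g x.2.1))
          (ν.prod (m.prod m)) := (hgc.comp_fst (ν := m)).comp_snd (μ := ν)
      have h2 : AEStronglyMeasurable (fun x : ℂ × ℂ × ℂ => (starRingEnd ℂ) (g x.2.2))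
          (ν.prod (m.prod m)) := (hgc.comp_snd (μ := m)).comp_snd (μ := ν)
      have h3 : AEStronglyMeasurable (fun x : ℂ × ℂ × ℂ => dirichletKernelDeriv x.2.1 x.1)
          (ν.prod (m.prod m)) := Measurable.aestronglyMeasurable (by fun_prop)
      have h4 : AEStronglyMeasurable (fun x : ℂ × ℂ × ℂ => dirichletKernelDeriv x.2.2 x.1)
          (ν.prod (m.prod m)) := Measurable.aestronglyMeasurable (by fun_prop)
      exact (h1.mul h3).mul (Complex.continuous_conj.comp_aestronglyMeasurable (h2.mul h4))
    · have a1 : ∀ᵐ x : ℂ × ℂ × ℂ ∂(ν.prod (m.prod m)), ‖x.1‖ < 1 :=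
        Measure.quasiMeasurePreserving_fst.ae ae_norm_lt_one_volume_ball
      have a2 : ∀ᵐ x : ℂ × ℂ × ℂ ∂(ν.prod (m.prod m)), ‖x.2.1‖ < r ∧ ‖g x.2.1‖ ≤ B :=
        Measure.quasiMeasurePreserving_snd.ae
          (Measure.quasiMeasurePreserving_fst.ae (hm.and hB))
      have a3 : ∀ᵐ x : ℂ × ℂ × ℂ ∂(ν.prod (m.prod m)), ‖x.2.2‖ < r ∧ ‖g x.2.2‖ ≤ B :=
        Measure.quasiMeasurePreserving_snd.ae
          (Measure.quasiMeasurePreserving_snd.ae (hm.and hB))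
      filter_upwards [a1, a2, a3] with x h1 h2 h3
      have hb {w : ℂ} (h : ‖w‖ < r ∧ ‖g w‖ ≤ B) : ‖φ w x.1‖ ≤ B * (1 / (1 - r)) := by
        simp only [hφ, norm_mul, RCLike.norm_conj]
        have := norm_dirichletKernelDeriv_le hr h.1.le h1.le
        exact mul_le_mul h.2 this (norm_nonneg _) ((norm_nonneg _).trans h.2)
      simp only [Function.uncurry, norm_mul, RCLike.norm_conj (φ x.2.2 x.1)]
      exact mul_le_mul (hb h2) (hb h3) (norm_nonneg _) ((norm_nonneg _).trans (hb h2))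
  have hci : Integrable (fun z => ((‖dirichletSynthesis m g z‖ ^ 2 : ℝ) : ℂ)) ν := by
    simp only [hsq]
    exact hint.integral_prod_left
  have hri : Integrable (fun z => ‖dirichletSynthesis m g z‖ ^ 2) ν := by
    simpa only [RCLike.re_to_complex, Complex.ofReal_re] using hci.re
  refine ⟨hri, ?_⟩
  obtain ⟨hs1, hs2⟩ := integrable_and_integral_logKernel_le hr hm (q := fun w => ‖g w‖ ^ 2)
    (hg.norm.pow 2) (B := B ^ 2) (by
      filter_upwards [hB] with w hw
      rw [norm_pow, norm_norm]
      gcongr) (fun w => by positivity) hC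
  have hcalc : ((∫ z, ‖dirichletSynthesis m g z‖ ^ 2 ∂ν : ℝ) : ℂ) =
      ∫ p : ℂ × ℂ, ∫ z, φ p.1 z * (starRingEnd ℂ) (φ p.2 z) ∂ν ∂(m.prod m) := by
    rw [← integral_integral_swap hint, ← integral_complex_ofReal]
    exact integral_congr_ae (.of_forall hsq)
  have hle : ‖∫ p : ℂ × ℂ, ∫ z, φ p.1 z * (starRingEnd ℂ) (φ p.2 z) ∂ν ∂(m.prod m)‖ ≤
      ∫ p : ℂ × ℂ, Real.pi / 2 * ((‖g p.1‖ ^ 2 + ‖g p.2‖ ^ 2) * logKernel p.1 p.2)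
        ∂(m.prod m) := by
    refine norm_integral_le_of_norm_le (hs1.const_mul _) ?_
    filter_upwards [hm1, hm2] with p h1 h2
    have h1 := h1.trans hr
    have h2 := h2.trans hr
    have e (z : ℂ) : φ p.1 z * (starRingEnd ℂ) (φ p.2 z) = ((starRingEnd ℂ) (g p.1) * g p.2) *
        ((starRingEnd ℂ) (dirichletKernelDeriv p.2 z) * dirichletKernelDeriv p.1 z) := by
      simp only [hφ, map_mul, Complex.conj_conj]
      ring
    simp only [e]
    rw [integral_const_mul, hν, integral_conj_dirichletKernelDeriv_mul h1 h2]
    simp only [norm_mul, norm_neg, RCLike.norm_conj, Complex.norm_real,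
      Real.norm_of_nonneg Real.pi_pos.le]
    have h3 := norm_log_one_sub_le_logKernel h2 h1
    rw [logKernel_comm] at h3
    calc ‖g p.1‖ * ‖g p.2‖ * (Real.pi * ‖Complex.log (1 - (starRingEnd ℂ) p.2 * p.1)‖)
        ≤ ‖g p.1‖ * ‖g p.2‖ * (Real.pi * logKernel p.1 p.2) := by
          have := Real.pi_pos
          gcongr
      _ = Real.pi / 2 * ((2 * ‖g p.1‖ * ‖g p.2‖) * logKernel p.1 p.2) := by ring
      _ ≤ _ := by
          have := Real.pi_pos
          have := logKernel_nonneg h1 h2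
          gcongr
          exact two_mul_le_add_sq _ _
  rw [← hcalc, Complex.norm_real, integral_const_mul] at hle
  refine (le_abs_self _).trans (hle.trans ?_)
  calc _ ≤ Real.pi / 2 * (2 * (C * ∫ w, ‖g w‖ ^ 2 ∂m)) := by
        have := Real.pi_pos
        gcongr
    _ = _ := by ring

theorem integral_norm_sq_sub_le {m : Measure ℂ} [IsFiniteMeasure m] {r C : ℝ}
    (hr : r < 1) (hm : ∀ᵐ w ∂m, ‖w‖ < r) {f : ℂ → ℂ} (hf : InDirichlet f)
    (hg : AEStronglyMeasurable f m) {B : ℝ} (hB : ∀ᵐ w ∂m, ‖f w - f 0‖ ≤ B) (hC0 : 0 < C)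
    (hC : ∀ w : ℂ, ‖w‖ < r → ∫ u, logKernel w u ∂m ≤ C) :
    Real.pi * ∫ w, ‖f w - f 0‖ ^ 2 ∂m ≤ C * ∫ z in ball (0 : ℂ) 1, ‖deriv f z‖ ^ 2 := by
  obtain ⟨hd, hd2⟩ := hf
  have hdi : IntegrableOn (deriv f) (ball 0 1) :=
    ((memLp_two_iff_integrable_sq_norm (measurable_deriv f).aestronglyMeasurable).2
      hd2).integrable one_le_two
  set g : ℂ → ℂ := fun w => f w - f 0 with hg_def
  have hgm : AEStronglyMeasurable g m := hg.sub aestronglyMeasurable_const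
  have hgi : Integrable g m := Integrable.of_bound hgm B hB
  obtain ⟨hG1, hG2⟩ := integrable_dirichletSynthesis_and_le hr hm hgm hB hC
  have hgci : Integrable (fun w => (starRingEnd ℂ) (g w)) m :=
    Integrable.of_bound (Complex.continuous_conj.comp_aestronglyMeasurable hgm) B
      (by simpa only [RCLike.norm_conj] using hB)
  have hint : Integrable (Function.uncurry fun w z : ℂ =>
      (starRingEnd ℂ) (g w) * deriv f z * dirichletKernelDeriv w z)
      (m.prod (volume.restrict (ball 0 1))) := by
    refine (hgci.mul_prod hdi).mul_bdd (c := 1 / (1 - r))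
      (measurable_fst.dirichletKernelDeriv measurable_snd).aestronglyMeasurable ?_
    have a1 : ∀ᵐ x : ℂ × ℂ ∂(m.prod (volume.restrict (ball 0 1))), ‖x.1‖ < r :=
      Measure.quasiMeasurePreserving_fst.ae hm
    have a2 : ∀ᵐ x : ℂ × ℂ ∂(m.prod (volume.restrict (ball 0 1))), ‖x.2‖ < 1 :=
      Measure.quasiMeasurePreserving_snd.ae ae_norm_lt_one_volume_ball
    filter_upwards [a1, a2] with x h1 h2
    exact norm_dirichletKernelDeriv_le hr h1.le h2.le
  have hrep : ((Real.pi * ∫ w, ‖g w‖ ^ 2 ∂m : ℝ) : ℂ) =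
      ∫ z in ball (0 : ℂ) 1, deriv f z * dirichletSynthesis m g z := by
    have h1 : ((Real.pi * ∫ w, ‖g w‖ ^ 2 ∂m : ℝ) : ℂ) =
        ∫ w, (∫ z in ball (0 : ℂ) 1,
          (starRingEnd ℂ) (g w) * deriv f z * dirichletKernelDeriv w z) ∂m := by
      rw [← integral_const_mul, ← integral_complex_ofReal]
      refine integral_congr_ae ?_
      filter_upwards [hm] with w hw
      simp only [mul_assoc]
      rw [integral_const_mul, integral_deriv_mul_dirichletKernelDeriv hd hdi (hw.trans hr)]
      push_cast
      rw [← Complex.conj_mul']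
      ring
    rw [h1, integral_integral_swap hint]
    refine integral_congr_ae (.of_forall fun z => ?_)
    simp only [dirichletSynthesis]
    rw [← integral_const_mul]
    exact integral_congr_ae (.of_forall fun w => by ring)
  have hle : ‖∫ z in ball (0 : ℂ) 1, deriv f z * dirichletSynthesis m g z‖ ≤
      ∫ z in ball (0 : ℂ) 1,
        (C / 2 * ‖deriv f z‖ ^ 2 + 1 / (2 * C) * ‖dirichletSynthesis m g z‖ ^ 2) := by
    refine norm_integral_le_of_norm_le ((hd2.const_mul _).add (hG1.const_mul _))
      (.of_forall fun z => ?_)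
    rw [norm_mul]
    have h := sq_nonneg (C * ‖deriv f z‖ - ‖dirichletSynthesis m g z‖)
    have e : C / 2 * ‖deriv f z‖ ^ 2 + 1 / (2 * C) * ‖dirichletSynthesis m g z‖ ^ 2 -
        ‖deriv f z‖ * ‖dirichletSynthesis m g z‖ =
        (C * ‖deriv f z‖ - ‖dirichletSynthesis m g z‖) ^ 2 / (2 * C) := by
      field_simp
      ring
    have : 0 ≤ (C * ‖deriv f z‖ - ‖dirichletSynthesis m g z‖) ^ 2 / (2 * C) := by positivity
    linarith
  rw [← hrep, Complex.norm_real, integral_add (hd2.const_mul _) (hG1.const_mul _),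
    integral_const_mul, integral_const_mul] at hle
  have h1 := (le_abs_self _).trans hle
  have h2 : 1 / (2 * C) * ∫ z in ball (0 : ℂ) 1, ‖dirichletSynthesis m g z‖ ^ 2 ≤
      Real.pi * (∫ w, ‖g w‖ ^ 2 ∂m) / 2 := by
    calc _ ≤ 1 / (2 * C) * (Real.pi * (C * ∫ w, ‖g w‖ ^ 2 ∂m)) := by gcongr
      _ = _ := by field_simp
  linarith

/-- If `sup_{w ∈ 𝔻} ∫_𝔻 log(2/|1 - w̄z|) dμ(z) < ∞` then `μ` is a Carleson measure for
the Dirichlet space. -/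
theorem statement6 (μ : Measure ℂ) [IsFiniteMeasure μ]
    (hμsupp : μ (Metric.ball (0:ℂ) 1)ᶜ = 0)
    (M : ℝ)
    (hM : ∀ w ∈ Metric.ball (0:ℂ) 1,
      (∫⁻ z in Metric.ball (0:ℂ) 1,
          ENNReal.ofReal (Real.log (2 / ‖1 - (starRingEnd ℂ) w * z‖)) ∂μ) ≤
        ENNReal.ofReal M) :
    IsCarlesonDirichlet μ := by
  set c : ℝ := Real.log 2 + Real.pi with hc
  have hc0 : 0 ≤ c := add_nonneg (Real.log_nonneg one_le_two) Real.pi_pos.le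
  set C : ℝ := max M 0 + c * μ.real univ + 1 with hC
  have hC0 : 0 < C := by
    have := le_max_right M 0
    have := mul_nonneg hc0 (measureReal_nonneg (μ := μ) (s := univ))
    linarith
  have hball : ball (0 : ℂ) 1 = ⋃ n : ℕ, ball (0 : ℂ) (1 - 1 / ((n : ℝ) + 1)) := by
    ext z
    simp only [mem_iUnion, mem_ball_zero_iff]
    constructor
    · intro hz
      obtain ⟨n, hn⟩ := exists_nat_one_div_lt (sub_pos.2 hz)
      exact ⟨n, by linarith⟩
    · rintro ⟨n, hn⟩
      have : 0 < 1 / ((n : ℝ) + 1) := by positivity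
      linarith
  have hmono : Monotone fun n : ℕ => ball (0 : ℂ) (1 - 1 / ((n : ℝ) + 1)) := fun a b hab =>
    ball_subset_ball (by gcongr)
  refine ⟨2 * μ.real univ + 2 * C, fun f hf => ?_⟩
  nth_rewrite 1 [hball]
  rw [setLIntegral_iUnion_of_directed _ hmono.directed_le]
  refine iSup_le fun n => ?_
  set r : ℝ := 1 - 1 / ((n : ℝ) + 1) with hr_def
  have hr : r < 1 := by
    have : 0 < 1 / ((n : ℝ) + 1) := by positivity
    linarith
  set m := μ.restrict (ball (0 : ℂ) r) with hm_def
  have hm : ∀ᵐ w ∂m, ‖w‖ < r :=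
    (ae_restrict_iff' measurableSet_ball).2 (.of_forall fun _ hz => mem_ball_zero_iff.1 hz)
  have hcont : ContinuousOn f (closedBall 0 r) :=
    hf.1.continuousOn.mono (closedBall_subset_ball hr)
  have hfm : AEStronglyMeasurable f m :=
    (hcont.mono ball_subset_closedBall).aestronglyMeasurable measurableSet_ball
  obtain ⟨B, hB⟩ := (isCompact_closedBall (0 : ℂ) r).exists_bound_of_continuousOn
    (hcont.sub (continuousOn_const (c := f 0)))
  have hB' : ∀ᵐ w ∂m, ‖f w - f 0‖ ≤ B := by
    filter_upwards [hm] with w hw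
    exact hB w (by simpa using hw.le)
  have hmass : m.real univ ≤ μ.real univ := by
    rw [hm_def, measureReal_restrict_apply_univ]
    exact measureReal_mono (subset_univ _)
  have hCm : ∀ w : ℂ, ‖w‖ < r → ∫ u, logKernel w u ∂m ≤ C := by
    intro w hw
    have hw1 := hw.trans hr
    have hpos : 0 ≤ᵐ[m] fun u => Real.log (2 / ‖1 - (starRingEnd ℂ) w * u‖) := by
      filter_upwards [hm] with u hu
      exact log_two_div_nonneg hw1 (hu.trans hr)
    have hle : ∫⁻ u, ENNReal.ofReal (Real.log (2 / ‖1 - (starRingEnd ℂ) w * u‖)) ∂m ≤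
        ENNReal.ofReal M :=
      (lintegral_mono_set (ball_subset_ball hr.le)).trans (hM w (mem_ball_zero_iff.2 hw1))
    have hmeas : AEStronglyMeasurable
        (fun u => Real.log (2 / ‖1 - (starRingEnd ℂ) w * u‖)) m :=
      Measurable.aestronglyMeasurable (by fun_prop)
    have hi : Integrable (fun u => Real.log (2 / ‖1 - (starRingEnd ℂ) w * u‖)) m := by
      refine ⟨hmeas, ?_⟩
      rw [hasFiniteIntegral_iff_ofReal hpos]
      exact hle.trans_lt ENNReal.ofReal_lt_top
    have hreal : ∫ u, Real.log (2 / ‖1 - (starRingEnd ℂ) w * u‖) ∂m ≤ max M 0 := by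
      rw [integral_eq_lintegral_of_nonneg_ae hpos hmeas]
      refine (ENNReal.toReal_mono ENNReal.ofReal_ne_top hle).trans_eq ?_
      exact ENNReal.toReal_ofReal'
    unfold logKernel
    rw [integral_add hi (integrable_const _), integral_const, smul_eq_mul, ← hc]
    have := mul_le_mul_of_nonneg_left hmass hc0
    linarith
  have hmain := integral_norm_sq_sub_le hr hm hf hfm hB' hC0 hCm
  set D : ℝ := ∫ z in ball (0 : ℂ) 1, ‖deriv f z‖ ^ 2 with hD
  have hD0 : 0 ≤ D := integral_nonneg fun z => by positivity
  have hgi : Integrable (fun w => ‖f w - f 0‖ ^ 2) m := by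
    refine Integrable.of_bound ((hfm.sub aestronglyMeasurable_const).norm.pow 2) (B ^ 2) ?_
    filter_upwards [hB'] with w hw
    rw [norm_pow, norm_norm]
    gcongr
  have hfi : Integrable (fun w => 2 * ‖f w - f 0‖ ^ 2 + 2 * ‖f 0‖ ^ 2) m :=
    (hgi.const_mul 2).add (integrable_const _)
  calc ∫⁻ w in ball (0 : ℂ) r, ENNReal.ofReal (‖f w‖ ^ 2) ∂μ
      ≤ ∫⁻ w, ENNReal.ofReal (2 * ‖f w - f 0‖ ^ 2 + 2 * ‖f 0‖ ^ 2) ∂m := by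
        refine lintegral_mono fun w => ENNReal.ofReal_le_ofReal ?_
        have h1 : ‖f w‖ ≤ ‖f w - f 0‖ + ‖f 0‖ := by
          simpa using norm_add_le (f w - f 0) (f 0)
        nlinarith [sq_nonneg (‖f w - f 0‖ - ‖f 0‖), norm_nonneg (f w)]
    _ = ENNReal.ofReal (∫ w, (2 * ‖f w - f 0‖ ^ 2 + 2 * ‖f 0‖ ^ 2) ∂m) :=
        (ofReal_integral_eq_lintegral_ofReal hfi (.of_forall fun w => by positivity)).symm
    _ ≤ _ := by
        refine ENNReal.ofReal_le_ofReal ?_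
        rw [integral_add (hgi.const_mul 2) (integrable_const _), integral_const_mul,
          integral_const, smul_eq_mul, dirichletNormSq, ← hD]
        have hp := Real.pi_pos
        have h1 : ∫ w, ‖f w - f 0‖ ^ 2 ∂m ≤ C * (1 / Real.pi * D) := by
          rw [← mul_le_mul_iff_right₀ hp]
          refine hmain.trans_eq ?_
          field_simp
        have h2 : m.real univ * ‖f 0‖ ^ 2 ≤ μ.real univ * ‖f 0‖ ^ 2 := by gcongr
        have h3 : 0 ≤ μ.real univ * (1 / Real.pi * D) := by positivity
        have h4 : 0 ≤ C * ‖f 0‖ ^ 2 := by positivity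
        linarith

end
end

section
/- Let μ be a finite positive Borel measure on the open unit disk 𝔻 that is a Carleson measure for the Dirichlet space 𝒟. Then μ(S(I)) = O(1/log(1/|I|)) as |I| → 0; that is, there exist constants C > 0 and ε > 0 such that μ(S(I)) ≤ C/log(1/|I|) for every arc I of the unit circle with |I| < ε. -/
open MeasureTheory Metric Complex Filter Set

noncomputable section

/-- The profile `y ↦ y⁻²` cut off to `[ℓ, 3]`. -/
def cutoffInvSq (ℓ : ℝ) : ℝ → ℝ := (Set.Icc ℓ 3).indicator fun y => (y ^ 2)⁻¹

lemma mul_cutoffInvSq {ℓ : ℝ} (hℓ : 0 < ℓ) :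
    (fun y : ℝ => y ^ (Module.finrank ℝ ℂ - 1) • cutoffInvSq ℓ y) =
      (Set.Icc ℓ 3).indicator fun y => y⁻¹ := by
  funext y
  by_cases hy : y ∈ Set.Icc ℓ 3
  · have : y ≠ 0 := (hℓ.trans_le hy.1).ne'
    simp only [cutoffInvSq, Set.indicator_of_mem hy, Complex.finrank_real_complex, smul_eq_mul]
    field_simp
    norm_num
  · simp [cutoffInvSq, Set.indicator_of_notMem hy]

lemma integrable_cutoffInvSq_norm {ℓ : ℝ} (hℓ : 0 < ℓ) :
    Integrable fun z : ℂ => cutoffInvSq ℓ ‖z‖ := by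
  rw [integrable_fun_norm_addHaar volume, mul_cutoffInvSq hℓ]
  refine Integrable.integrableOn ((integrable_indicator_iff measurableSet_Icc).2 ?_)
  refine ContinuousOn.integrableOn_Icc (continuousOn_id.inv₀ fun y hy => ?_)
  exact (hℓ.trans_le hy.1).ne'

lemma integral_cutoffInvSq_norm {ℓ : ℝ} (hℓ : 0 < ℓ) (hℓ3 : ℓ ≤ 3) :
    ∫ z : ℂ, cutoffInvSq ℓ ‖z‖ = 2 * Real.pi * Real.log (3 / ℓ) := by
  have hsub : Set.Ioi (0 : ℝ) ∩ Set.Icc ℓ 3 = Set.Icc ℓ 3 :=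
    Set.inter_eq_right.2 fun y hy => hℓ.trans_le hy.1
  rw [integral_fun_norm_addHaar volume, mul_cutoffInvSq hℓ,
    setIntegral_indicator measurableSet_Icc, hsub, integral_Icc_eq_integral_Ioc,
    ← intervalIntegral.integral_of_le hℓ3, integral_inv_of_pos hℓ (by norm_num)]
  simp [Measure.real, Complex.finrank_real_complex]
  ring

lemma inv_norm_sub_sq_eq_cutoffInvSq {ℓ : ℝ} (hℓ1 : ℓ < 1) {p z : ℂ}
    (hp : ‖p‖ = 1 + ℓ) (hz : z ∈ Metric.ball (0 : ℂ) 1) :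
    (‖z - p‖ ^ 2)⁻¹ = cutoffInvSq ℓ ‖z - p‖ := by
  rw [mem_ball_zero_iff] at hz
  have h1 := norm_sub_le z p
  have h2 := norm_sub_norm_le p z
  rw [norm_sub_rev] at h2
  have hmem : ‖z - p‖ ∈ Set.Icc ℓ 3 := ⟨by linarith, by linarith⟩
  rw [cutoffInvSq, Set.indicator_of_mem hmem]

lemma integrableOn_inv_norm_sub_sq {ℓ : ℝ} (hℓ : 0 < ℓ) (hℓ1 : ℓ < 1) {p : ℂ}
    (hp : ‖p‖ = 1 + ℓ) :
    IntegrableOn (fun z => (‖z - p‖ ^ 2)⁻¹) (Metric.ball (0 : ℂ) 1) :=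
  ((integrable_cutoffInvSq_norm hℓ).comp_sub_right p).integrableOn.congr_fun
    (fun _ hz => (inv_norm_sub_sq_eq_cutoffInvSq hℓ1 hp hz).symm) measurableSet_ball

lemma setIntegral_inv_norm_sub_sq_le {ℓ : ℝ} (hℓ : 0 < ℓ) (hℓ1 : ℓ < 1) {p : ℂ}
    (hp : ‖p‖ = 1 + ℓ) :
    ∫ z in Metric.ball (0 : ℂ) 1, (‖z - p‖ ^ 2)⁻¹ ≤ 2 * Real.pi * Real.log (3 / ℓ) := by
  rw [setIntegral_congr_fun measurableSet_ball
      fun _ hz => inv_norm_sub_sq_eq_cutoffInvSq hℓ1 hp hz,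
    ← integral_cutoffInvSq_norm hℓ (by linarith),
    ← integral_sub_right_eq_self (fun z : ℂ => cutoffInvSq ℓ ‖z‖) p]
  refine setIntegral_le_integral ((integrable_cutoffInvSq_norm hℓ).comp_sub_right p)
    (Eventually.of_forall fun z => ?_)
  exact Set.indicator_nonneg (fun _ _ => by positivity) _

/-- The logarithm with its singularity at `(1 + ℓ) e^{iθ}`, just outside the disk. -/
def logTest (θ ℓ : ℝ) (z : ℂ) : ℂ := Complex.log (1 + ℓ - Complex.exp (-θ * Complex.I) * z)

lemma norm_exp_neg_mul_I (θ : ℝ) : ‖Complex.exp (-θ * Complex.I)‖ = 1 := by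
  simpa using Complex.norm_exp_ofReal_mul_I (-θ)

lemma norm_one_add_sub_exp_mul (θ ℓ : ℝ) (z : ℂ) :
    ‖(1 + ℓ - Complex.exp (-θ * Complex.I) * z : ℂ)‖ =
      ‖z - (1 + ℓ) * Complex.exp (θ * Complex.I)‖ := by
  have h : (1 + ℓ - Complex.exp (-θ * Complex.I) * z : ℂ) =
      -(Complex.exp (-θ * Complex.I) * (z - (1 + ℓ) * Complex.exp (θ * Complex.I))) := by
    have h1 : Complex.exp (-θ * Complex.I) * Complex.exp (θ * Complex.I) = 1 := by
      rw [← Complex.exp_add]; simp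
    linear_combination (-(1 + ℓ) : ℂ) * h1
  rw [h, norm_neg, norm_mul, norm_exp_neg_mul_I, one_mul]

lemma one_add_sub_exp_mul_mem_slitPlane {θ ℓ : ℝ} (hℓ : 0 < ℓ) {z : ℂ}
    (hz : z ∈ Metric.ball (0 : ℂ) 1) :
    (1 + ℓ - Complex.exp (-θ * Complex.I) * z : ℂ) ∈ Complex.slitPlane := by
  left
  rw [mem_ball_zero_iff] at hz
  have h := Complex.re_le_norm (Complex.exp (-θ * Complex.I) * z)
  rw [norm_mul, norm_exp_neg_mul_I, one_mul] at h
  simp only [Complex.sub_re, Complex.add_re, Complex.one_re, Complex.ofReal_re]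
  linarith

lemma hasDerivAt_logTest {θ ℓ : ℝ} (hℓ : 0 < ℓ) {z : ℂ} (hz : z ∈ Metric.ball (0 : ℂ) 1) :
    HasDerivAt (logTest θ ℓ)
      (-(Complex.exp (-θ * Complex.I)) / (1 + ℓ - Complex.exp (-θ * Complex.I) * z)) z := by
  have h : HasDerivAt (fun z : ℂ => 1 + ℓ - Complex.exp (-θ * Complex.I) * z)
      (-(Complex.exp (-θ * Complex.I))) z := by
    simpa using ((hasDerivAt_id z).const_mul (Complex.exp (-θ * Complex.I))).const_sub (1 + ℓ : ℂ)
  exact h.clog (one_add_sub_exp_mul_mem_slitPlane hℓ hz)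

lemma norm_deriv_logTest_sq {θ ℓ : ℝ} (hℓ : 0 < ℓ) {z : ℂ} (hz : z ∈ Metric.ball (0 : ℂ) 1) :
    ‖deriv (logTest θ ℓ) z‖ ^ 2 = (‖z - (1 + ℓ) * Complex.exp (θ * Complex.I)‖ ^ 2)⁻¹ := by
  rw [(hasDerivAt_logTest hℓ hz).deriv, norm_div, norm_neg, norm_exp_neg_mul_I,
    norm_one_add_sub_exp_mul, one_div, inv_pow]

lemma norm_one_add_mul_exp {θ ℓ : ℝ} (hℓ : 0 < ℓ) :
    ‖((1 + ℓ) * Complex.exp (θ * Complex.I) : ℂ)‖ = 1 + ℓ := by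
  rw [norm_mul, Complex.norm_exp_ofReal_mul_I, mul_one, ← Complex.ofReal_one,
    ← Complex.ofReal_add, Complex.norm_of_nonneg (by linarith)]

lemma inDirichlet_logTest {θ ℓ : ℝ} (hℓ : 0 < ℓ) (hℓ1 : ℓ < 1) :
    InDirichlet (logTest θ ℓ) :=
  ⟨fun _ hz => (hasDerivAt_logTest hℓ hz).differentiableAt.differentiableWithinAt,
    (integrableOn_inv_norm_sub_sq hℓ hℓ1 (norm_one_add_mul_exp hℓ)).congr_fun
      (fun _ hz => (norm_deriv_logTest_sq hℓ hz).symm) measurableSet_ball⟩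

lemma dirichletNormSq_logTest_le {θ ℓ : ℝ} (hℓ : 0 < ℓ) (hℓ1 : ℓ < 1) :
    dirichletNormSq (logTest θ ℓ) ≤ 1 + 2 * Real.log (3 / ℓ) := by
  have h0 : ‖logTest θ ℓ 0‖ ≤ 1 := by
    have h : logTest θ ℓ 0 = (Real.log (1 + ℓ) : ℂ) := by
      rw [logTest, mul_zero, sub_zero, Complex.ofReal_log (by linarith)]
      simp
    rw [h, Complex.norm_of_nonneg (Real.log_nonneg (by linarith))]
    linarith [Real.log_le_sub_one_of_pos (show 0 < 1 + ℓ by linarith)]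
  have hI : ∫ z in Metric.ball (0 : ℂ) 1, ‖deriv (logTest θ ℓ) z‖ ^ 2 ≤
      2 * Real.pi * Real.log (3 / ℓ) := by
    rw [setIntegral_congr_fun measurableSet_ball fun _ hz => norm_deriv_logTest_sq hℓ hz]
    exact setIntegral_inv_norm_sub_sq_le hℓ hℓ1 (norm_one_add_mul_exp hℓ)
  refine add_le_add (pow_le_one₀ (norm_nonneg _) h0) ?_
  calc _ ≤ 1 / Real.pi * (2 * Real.pi * Real.log (3 / ℓ)) := by gcongr
    _ = 2 * Real.log (3 / ℓ) := by field_simp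

lemma norm_sub_le_of_mem_carlesonBox {θ ℓ : ℝ} (hℓ : 0 < ℓ) (hℓ1 : ℓ < 1) {z : ℂ}
    (hz : z ∈ carlesonBox θ ℓ) :
    ‖z‖ < 1 ∧ ‖z - (1 + ℓ) * Complex.exp (θ * Complex.I)‖ ≤ 3 * ℓ := by
  obtain ⟨r, α, hr, hr1, hα, hα', rfl⟩ := hz
  have hr0 : 0 < r := by linarith
  have hnorm : ‖(r * Complex.exp (α * Complex.I) : ℂ)‖ = r := by
    rw [norm_mul, Complex.norm_exp_ofReal_mul_I, mul_one, Complex.norm_of_nonneg hr0.le]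
  refine ⟨hnorm.trans_lt hr1, ?_⟩
  have hsplit : (r * Complex.exp (α * Complex.I) - (1 + ℓ) * Complex.exp (θ * Complex.I) : ℂ) =
      Complex.exp (θ * Complex.I) *
        (r * (Complex.exp (Complex.I * (α - θ : ℝ)) - 1) + ((r - 1 - ℓ : ℝ) : ℂ)) := by
    have h : Complex.exp (α * Complex.I) =
        Complex.exp (θ * Complex.I) * Complex.exp (Complex.I * (α - θ : ℝ)) := by
      rw [← Complex.exp_add]; congr 1; push_cast; ring
    rw [h]; push_cast; ring
  have hchord : ‖Complex.exp (Complex.I * (α - θ : ℝ)) - 1‖ ≤ ℓ := by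
    refine (Real.norm_exp_I_mul_ofReal_sub_one_le).trans ?_
    rw [Real.norm_of_nonneg (by linarith)]; linarith
  rw [hsplit, norm_mul, Complex.norm_exp_ofReal_mul_I, one_mul]
  refine (norm_add_le _ _).trans ?_
  rw [norm_mul, Complex.norm_of_nonneg hr0.le, Complex.norm_real, Real.norm_eq_abs,
    abs_of_nonpos (by linarith)]
  nlinarith [norm_nonneg (Complex.exp (Complex.I * (α - θ : ℝ)) - 1)]

lemma log_le_norm_logTest {θ ℓ : ℝ} (hℓ : 0 < ℓ) {z : ℂ} (hz : z ∈ Metric.ball (0 : ℂ) 1)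
    (h : ‖z - (1 + ℓ) * Complex.exp (θ * Complex.I)‖ ≤ 3 * ℓ) :
    Real.log (1 / (3 * ℓ)) ≤ ‖logTest θ ℓ z‖ := by
  have hpos : 0 < ‖(1 + ℓ - Complex.exp (-θ * Complex.I) * z : ℂ)‖ :=
    norm_pos_iff.2 (Complex.slitPlane_ne_zero (one_add_sub_exp_mul_mem_slitPlane hℓ hz))
  rw [← norm_one_add_sub_exp_mul] at h
  calc Real.log (1 / (3 * ℓ)) = -Real.log (3 * ℓ) := by rw [one_div, Real.log_inv]
    _ ≤ -Real.log ‖(1 + ℓ - Complex.exp (-θ * Complex.I) * z : ℂ)‖ :=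
      neg_le_neg (Real.log_le_log hpos h)
    _ = -(logTest θ ℓ z).re := by rw [logTest, Complex.log_re]
    _ ≤ ‖logTest θ ℓ z‖ := (neg_le_abs _).trans (Complex.abs_re_le_norm _)

/-- **Necessity.** If `μ` is a finite Borel measure on the unit disk which is a Carleson
measure for the Dirichlet space, then `μ(S(I)) = O(1/log(1/|I|))` as `|I| → 0`. -/
theorem statement15 (μ : Measure ℂ) [IsFiniteMeasure μ]
    (hμsupp : μ (Metric.ball (0:ℂ) 1)ᶜ = 0)
    (hCarleson : IsCarlesonDirichlet μ) :
    ∃ C > (0:ℝ), ∃ ε > (0:ℝ), ∀ θ ℓ : ℝ, 0 < ℓ → ℓ < ε →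
      μ (carlesonBox θ ℓ) ≤ ENNReal.ofReal (C / Real.log (1 / ℓ)) := by
  obtain ⟨C, hC⟩ := hCarleson
  refine ⟨20 * (|C| + 1), by positivity, 1 / 9, by norm_num, fun θ ℓ hℓ hℓ9 => ?_⟩
  have hℓ1 : ℓ < 1 := by linarith
  set L := Real.log (1 / ℓ) with hL
  have hLneg : L = -Real.log ℓ := by rw [hL, one_div, Real.log_inv]
  have hlog3 : 1 / 2 ≤ Real.log 3 := by
    have := Real.log_le_log (by norm_num) (show (2 : ℝ) ≤ 3 by norm_num)
    linarith [Real.log_two_gt_d9]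
  have hL3 : 2 * Real.log 3 ≤ L := by
    have h9 : Real.log (3 ^ 2) ≤ L :=
      Real.log_le_log (by norm_num) (by rw [le_div_iff₀ hℓ]; linarith)
    simpa using h9
  have hLpos : 0 < L := by linarith
  set T := Metric.ball (0 : ℂ) 1 ∩
    {z | ‖z - (1 + ℓ) * Complex.exp (θ * Complex.I)‖ ≤ 3 * ℓ} with hT
  have hTmeas : MeasurableSet T :=
    measurableSet_ball.inter (measurableSet_le (by fun_prop) measurable_const)
  have hbox : carlesonBox θ ℓ ⊆ T := fun z hz =>
    ⟨mem_ball_zero_iff.2 (norm_sub_le_of_mem_carlesonBox hℓ hℓ1 hz).1,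
      (norm_sub_le_of_mem_carlesonBox hℓ hℓ1 hz).2⟩
  have hlower : ∀ z ∈ T, (L / 2) ^ 2 ≤ ‖logTest θ ℓ z‖ ^ 2 := by
    intro z hz
    refine pow_le_pow_left₀ (by positivity) (le_trans ?_ (log_le_norm_logTest hℓ hz.1 hz.2)) 2
    rw [one_div, Real.log_inv, Real.log_mul (by norm_num) hℓ.ne']
    linarith
  have hupper : C * dirichletNormSq (logTest θ ℓ) ≤ (|C| + 1) * (5 * L) := by
    have hD : dirichletNormSq (logTest θ ℓ) ≤ 5 * L := by
      refine (dirichletNormSq_logTest_le hℓ hℓ1).trans ?_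
      rw [Real.log_div (by norm_num) hℓ.ne']
      linarith
    have hD0 : 0 ≤ dirichletNormSq (logTest θ ℓ) := by
      unfold dirichletNormSq
      have := Real.pi_pos
      positivity
    gcongr
    linarith [le_abs_self C]
  have hmain : ENNReal.ofReal ((L / 2) ^ 2) * μ T ≤ ENNReal.ofReal ((|C| + 1) * (5 * L)) :=
    calc ENNReal.ofReal ((L / 2) ^ 2) * μ T
        = ∫⁻ _ in T, ENNReal.ofReal ((L / 2) ^ 2) ∂μ := (setLIntegral_const _ _).symm
      _ ≤ ∫⁻ z in T, ENNReal.ofReal (‖logTest θ ℓ z‖ ^ 2) ∂μ :=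
        setLIntegral_mono' hTmeas fun z hz => ENNReal.ofReal_le_ofReal (hlower z hz)
      _ ≤ ∫⁻ z in Metric.ball (0 : ℂ) 1, ENNReal.ofReal (‖logTest θ ℓ z‖ ^ 2) ∂μ :=
        lintegral_mono_set Set.inter_subset_left
      _ ≤ ENNReal.ofReal (C * dirichletNormSq (logTest θ ℓ)) :=
        hC _ (inDirichlet_logTest hℓ hℓ1)
      _ ≤ _ := ENNReal.ofReal_le_ofReal hupper
  have hval : 20 * (|C| + 1) / L = (|C| + 1) * (5 * L) / (L / 2) ^ 2 := by
    field_simp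
    norm_num
  refine (measure_mono hbox).trans ?_
  rw [hval, ENNReal.ofReal_div_of_pos (by positivity)]
  refine (ENNReal.le_div_iff_mul_le (Or.inl ?_) (Or.inl ENNReal.ofReal_ne_top)).2 ?_
  · exact (ENNReal.ofReal_pos.2 (by positivity)).ne'
  · rwa [mul_comm]

end
end

section
/- Let μ be the positive Borel measure supported on the radius [0, 1) ⊂ 𝔻 determined by μ([1 − t, 1)) = (log(2/t))^{−1} for all 0 < t ≤ 1. Then μ is a Carleson measure for the Dirichlet space 𝒟. -/
open MeasureTheory Metric Complex Filter Set

noncomputable section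

/-- A value of a holomorphic function is bounded by its circle means. -/
theorem two_pi_mul_enorm_le_lintegral_circle {f : ℂ → ℂ} {c : ℂ} {ρ r : ℝ}
    (hf : DifferentiableOn ℂ f (ball c ρ)) (hr : 0 < r) (hrρ : r < ρ) :
    ENNReal.ofReal (2 * Real.pi) * ‖f c‖ₑ ≤
      ∫⁻ θ in Ioo (-Real.pi) Real.pi, ‖f (c + Complex.polarCoord.symm (r, θ))‖ₑ := by
  have hd : DiffContOnCl ℂ f (ball c |r|) := by
    rw [abs_of_pos hr]
    exact (hf.mono (closedBall_subset_ball hrρ)).diffContOnCl_ball subset_rfl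
  have h1 := hd.circleAverage
  rw [Real.circleAverage_eq_integral_add (-Real.pi),
    intervalIntegral.integral_comp_add_right (fun θ => f (circleMap c r θ))] at h1
  have h2 : (2 * Real.pi) • f c = ∫ θ in Ioo (-Real.pi) Real.pi, f (circleMap c r θ) := by
    rw [← h1, smul_inv_smul₀ (by positivity), ← integral_Ioc_eq_integral_Ioo,
      ← intervalIntegral.integral_of_le (by linarith [Real.pi_pos])]
    congr 1 <;> ring
  have h3 : ENNReal.ofReal (2 * Real.pi) * ‖f c‖ₑ = ‖(2 * Real.pi) • f c‖ₑ := by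
    rw [enorm_smul, Real.enorm_of_nonneg (by positivity)]
  rw [h3, h2]
  refine (enorm_integral_le_lintegral_enorm _).trans (le_of_eq ?_)
  refine lintegral_congr fun θ => ?_
  simp [circleMap, Complex.exp_mul_I]

/-- The area sub-mean value property for the modulus of a holomorphic function. -/
theorem ofReal_pi_mul_sq_mul_enorm_le_lintegral_ball {f : ℂ → ℂ} {c : ℂ} {ρ : ℝ}
    (hf : DifferentiableOn ℂ f (ball c ρ)) (hρ : 0 < ρ) :
    ENNReal.ofReal (Real.pi * ρ ^ 2) * ‖f c‖ₑ ≤ ∫⁻ z in ball c ρ, ‖f z‖ₑ := by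
  set S : Set (ℝ × ℝ) := Ioo 0 ρ ×ˢ Ioo (-Real.pi) Real.pi with hS
  have hSm : MeasurableSet S := measurableSet_Ioo.prod measurableSet_Ioo
  have hmem : ∀ p ∈ S, c + Complex.polarCoord.symm p ∈ ball c ρ := by
    rintro p ⟨⟨hp0, hp1⟩, -⟩
    rw [mem_ball, dist_self_add_left, Complex.norm_polarCoord_symm, abs_of_pos hp0]
    exact hp1
  have hcont : ContinuousOn (fun p : ℝ × ℝ => f (c + Complex.polarCoord.symm p)) S := by
    refine hf.continuousOn.comp (Continuous.continuousOn ?_) hmem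
    simp only [Complex.polarCoord_symm_apply]
    fun_prop
  have hmeas : AEMeasurable
      (fun p : ℝ × ℝ => ENNReal.ofReal p.1 * ‖f (c + Complex.polarCoord.symm p)‖ₑ)
      (volume.restrict S) :=
    (by fun_prop : Measurable fun p : ℝ × ℝ => ENNReal.ofReal p.1).aemeasurable.mul
      (hcont.aestronglyMeasurable hSm).enorm
  have hr : ∫⁻ r in Ioo 0 ρ, ENNReal.ofReal r = ENNReal.ofReal (ρ ^ 2 / 2) := by
    rw [← ofReal_integral_eq_lintegral_ofReal, ← integral_Ioc_eq_integral_Ioo,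
      ← intervalIntegral.integral_of_le hρ.le, integral_id]
    · simp
    · exact (continuous_id.integrableOn_Icc (a := 0) (b := ρ)).mono_set Ioo_subset_Icc_self
    · filter_upwards [self_mem_ae_restrict measurableSet_Ioo] with r hr using hr.1.le
  calc ENNReal.ofReal (Real.pi * ρ ^ 2) * ‖f c‖ₑ
      = ∫⁻ r in Ioo 0 ρ, ENNReal.ofReal r * (ENNReal.ofReal (2 * Real.pi) * ‖f c‖ₑ) := by
        rw [lintegral_mul_const _ (by fun_prop), hr, ← mul_assoc,
          ← ENNReal.ofReal_mul (by positivity)]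
        congr 2
        ring
    _ ≤ ∫⁻ r in Ioo 0 ρ, ∫⁻ θ in Ioo (-Real.pi) Real.pi,
          ENNReal.ofReal r * ‖f (c + Complex.polarCoord.symm (r, θ))‖ₑ := by
        refine setLIntegral_mono' measurableSet_Ioo fun r hr => ?_
        rw [lintegral_const_mul' _ _ ENNReal.ofReal_ne_top]
        gcongr
        exact two_pi_mul_enorm_le_lintegral_circle hf hr.1 hr.2
    _ = ∫⁻ p in S, ENNReal.ofReal p.1 * ‖f (c + Complex.polarCoord.symm p)‖ₑ := by
        rw [hS, Measure.volume_eq_prod, setLIntegral_prod _ (by exact hmeas)]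
    _ = ∫⁻ p in S, ENNReal.ofReal p.1 •
          (ball c ρ).indicator (fun z => ‖f z‖ₑ) (c + Complex.polarCoord.symm p) := by
        refine setLIntegral_congr_fun hSm fun p hp => ?_
        simp only [indicator_of_mem (hmem p hp), smul_eq_mul]
    _ ≤ ∫⁻ p in polarCoord.target, ENNReal.ofReal p.1 •
          (ball c ρ).indicator (fun z => ‖f z‖ₑ) (c + Complex.polarCoord.symm p) := by
        refine lintegral_mono_set ?_
        rw [polarCoord_target]
        exact prod_mono Ioo_subset_Ioi_self subset_rfl
    _ = ∫⁻ z, (ball c ρ).indicator (fun z => ‖f z‖ₑ) (c + z) :=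
        Complex.lintegral_comp_polarCoord_symm
          fun z => (ball c ρ).indicator (fun z => ‖f z‖ₑ) (c + z)
    _ = ∫⁻ z in ball c ρ, ‖f z‖ₑ := by
        rw [lintegral_add_left_eq_self, lintegral_indicator measurableSet_ball]

/-- A weighted form of the discrete Hardy inequality. -/
theorem sum_sq_sum_range_div_le (b : ℕ → ℝ) (N : ℕ) :
    ∑ n ∈ Finset.range N, (∑ k ∈ Finset.range (n + 1), b k) ^ 2 / ((n + 1) * (n + 2)) ≤
      6 * ∑ k ∈ Finset.range N, b k ^ 2 := by
  have key : ∀ N : ℕ,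
      ∑ n ∈ Finset.range N, (∑ k ∈ Finset.range (n + 1), b k) ^ 2 / (((n : ℝ) + 1) * (n + 2)) +
        2 * (∑ k ∈ Finset.range N, b k) ^ 2 / ((N : ℝ) + 1) ≤
      6 * ∑ k ∈ Finset.range N, b k ^ 2 := by
    intro N
    induction N with
    | zero => simp
    | succ N ih =>
      rw [Finset.sum_range_succ, Finset.sum_range_succ (fun k => b k ^ 2),
        Finset.sum_range_succ b]
      set B := ∑ k ∈ Finset.range N, b k
      have step : (B + b N) ^ 2 / (((N : ℝ) + 1) * (N + 2)) +
          2 * (B + b N) ^ 2 / (((N + 1 : ℕ) : ℝ) + 1) ≤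
          2 * B ^ 2 / ((N : ℝ) + 1) + 6 * b N ^ 2 := by
        push_cast
        have hN : (0 : ℝ) ≤ N := N.cast_nonneg
        rw [← sub_nonneg]
        have : 2 * B ^ 2 / ((N : ℝ) + 1) + 6 * b N ^ 2 - ((B + b N) ^ 2 / (((N : ℝ) + 1) * (N + 2))
            + 2 * (B + b N) ^ 2 / ((N : ℝ) + 1 + 1)) =
            ((B - (2 * N + 3) * b N) ^ 2 + 2 * N * (N + 2) * b N ^ 2) / ((N + 1) * (N + 2)) := by
          field_simp
          ring
        rw [this]
        positivity
      linarith
  refine le_trans ?_ (key N)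
  have : 0 ≤ 2 * (∑ k ∈ Finset.range N, b k) ^ 2 / ((N : ℝ) + 1) := by positivity
  linarith

/-- The part of the unit disk at horizontal distance between `2⁻ʲ` and `2¹⁻ʲ` from the line
`re z = 1`. -/
def dyadicStrip (j : ℕ) : Set ℂ :=
  ball (0 : ℂ) 1 ∩ {z | (1 / 2) ^ j ≤ 1 - z.re ∧ 1 - z.re < 2 * (1 / 2) ^ j}

theorem dyadicStrip_subset (j : ℕ) : dyadicStrip j ⊆ ball (0 : ℂ) 1 := inter_subset_left

theorem measurableSet_dyadicStrip (j : ℕ) : MeasurableSet (dyadicStrip j) := by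
  refine measurableSet_ball.inter (MeasurableSet.inter ?_ ?_)
  · exact measurableSet_le measurable_const (measurable_const.sub Complex.measurable_re)
  · exact measurableSet_lt (measurable_const.sub Complex.measurable_re) measurable_const

theorem pairwise_disjoint_dyadicStrip : Pairwise (Function.onFun Disjoint dyadicStrip) := by
  have key : ∀ i j, i < j → Disjoint (dyadicStrip i) (dyadicStrip j) := by
    intro i j hij
    refine Set.disjoint_left.2 fun z hi hj => ?_
    have h1 : (1 / 2 : ℝ) ^ j ≤ (1 / 2) ^ (i + 1) :=
      pow_le_pow_of_le_one (by norm_num) (by norm_num) hij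
    have h2 := hi.2.1
    have h3 := hj.2.2
    rw [pow_succ] at h1
    linarith
  intro i j hij
  rcases lt_or_gt_of_ne hij with h | h
  · exact key i j h
  · exact (key j i h).symm

theorem sum_setIntegral_dyadicStrip_le {g : ℂ → ℝ} (hg0 : ∀ z, 0 ≤ g z)
    (hg : IntegrableOn g (ball 0 1)) (s : Finset ℕ) {A : Set ℂ} (hA : A ⊆ ball 0 1)
    (hs : ∀ j ∈ s, dyadicStrip j ⊆ A) :
    ∑ j ∈ s, ∫ z in dyadicStrip j, g z ≤ ∫ z in A, g z := by
  rw [← integral_biUnion_finset s (fun j _ => measurableSet_dyadicStrip j)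
    (fun i _ j _ hij => pairwise_disjoint_dyadicStrip hij)
    (fun j _ => hg.mono_set (dyadicStrip_subset j))]
  exact setIntegral_mono_set (hg.mono_set hA) (ae_of_all _ hg0)
    (LE.le.eventuallyLE (iUnion₂_subset hs))

theorem setIntegral_le_sum_dyadicStrip {g : ℂ → ℝ} (hg0 : ∀ z, 0 ≤ g z)
    (hg : IntegrableOn g (ball 0 1)) (s : Finset ℕ) {A : Set ℂ}
    (hs : A ⊆ ⋃ j ∈ s, dyadicStrip j) :
    ∫ z in A, g z ≤ ∑ j ∈ s, ∫ z in dyadicStrip j, g z := by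
  rw [← integral_biUnion_finset s (fun j _ => measurableSet_dyadicStrip j)
    (fun i _ j _ hij => pairwise_disjoint_dyadicStrip hij)
    (fun j _ => hg.mono_set (dyadicStrip_subset j))]
  exact setIntegral_mono_set (hg.mono_set (iUnion₂_subset fun j _ => dyadicStrip_subset j))
    (ae_of_all _ hg0) (LE.le.eventuallyLE hs)

/-- A ball of radius `2⁻ᵏ⁻²` around a point of the `k`-th dyadic interval of the radius meets
only three dyadic strips. -/
theorem ball_subset_iUnion_dyadicStrip {k : ℕ} {x : ℝ}
    (hx : x ∈ Icc (1 - (1 / 2 : ℝ) ^ k) (1 - (1 / 2) ^ (k + 1))) :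
    ball (x : ℂ) ((1 / 2) ^ (k + 2)) ⊆ ⋃ j ∈ Finset.Icc k (k + 2), dyadicStrip j := by
  intro z hz
  obtain ⟨h1, h2⟩ := hx
  have hp : (0 : ℝ) < (1 / 2) ^ k := by positivity
  have hp1 : (1 / 2 : ℝ) ^ k ≤ 1 := pow_le_one₀ (by norm_num) (by norm_num)
  rw [mem_ball, dist_eq_norm] at hz
  have hre : |z.re - x| < (1 / 2) ^ (k + 2) := by
    simpa using (Complex.abs_re_le_norm (z - x)).trans_lt hz
  obtain ⟨h3, h4⟩ := abs_lt.1 hre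
  have hb : z ∈ ball (0 : ℂ) 1 := by
    rw [mem_ball_zero_iff]
    have : ‖z‖ ≤ ‖z - x‖ + ‖(x : ℂ)‖ := by simpa using norm_add_le (z - x) (x : ℂ)
    rw [Complex.norm_of_nonneg (by linarith)] at this
    rw [pow_succ] at h2
    rw [pow_add] at hz
    linarith
  rw [pow_succ] at h2
  rw [pow_add] at h3 h4
  simp only [mem_iUnion, Finset.mem_Icc, exists_prop]
  by_cases c0 : (1 / 2 : ℝ) ^ k ≤ 1 - z.re
  · exact ⟨k, ⟨by lia, by lia⟩, hb, c0, by linarith⟩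
  by_cases c1 : (1 / 2 : ℝ) ^ (k + 1) ≤ 1 - z.re
  · refine ⟨k + 1, ⟨by lia, by lia⟩, hb, c1, ?_⟩
    rw [pow_succ]
    linarith
  · refine ⟨k + 2, ⟨by lia, by lia⟩, hb, ?_, ?_⟩ <;> rw [pow_succ] at c1 <;> rw [pow_add] <;>
      linarith

/-- The area sub-mean value property for the squared modulus of a holomorphic function. -/
theorem pi_mul_sq_mul_norm_sq_le_integral_ball {g : ℂ → ℂ} {c : ℂ} {ρ : ℝ}
    (hg : DifferentiableOn ℂ g (ball c ρ)) (hρ : 0 < ρ)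
    (hint : IntegrableOn (fun z => ‖g z‖ ^ 2) (ball c ρ)) :
    Real.pi * ρ ^ 2 * ‖g c‖ ^ 2 ≤ ∫ z in ball c ρ, ‖g z‖ ^ 2 := by
  have h := ofReal_pi_mul_sq_mul_enorm_le_lintegral_ball (hg.pow 2) hρ
  have e : ∀ z, ‖(g ^ 2) z‖ₑ = ENNReal.ofReal (‖g z‖ ^ 2) := fun z => by
    rw [Pi.pow_apply, ← ofReal_norm, norm_pow]
  simp only [e] at h
  rw [← ofReal_integral_eq_lintegral_ofReal hint (ae_of_all _ fun z => by positivity),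
    ← ENNReal.ofReal_mul (by positivity)] at h
  exact (ENNReal.ofReal_le_ofReal_iff (integral_nonneg fun z => by positivity)).1 h

/-- The oscillation bound on the `k`-th dyadic interval of the radius. -/
def dyadicOsc (f : ℂ → ℂ) (k : ℕ) : ℝ :=
  √(4 / Real.pi * ∑ j ∈ Finset.Icc k (k + 2), ∫ z in dyadicStrip j, ‖deriv f z‖ ^ 2)

theorem dyadicOsc_sq (f : ℂ → ℂ) (k : ℕ) : dyadicOsc f k ^ 2 =
    4 / Real.pi * ∑ j ∈ Finset.Icc k (k + 2), ∫ z in dyadicStrip j, ‖deriv f z‖ ^ 2 :=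
  Real.sq_sqrt (mul_nonneg (by positivity)
    (Finset.sum_nonneg fun _ _ => integral_nonneg fun _ => by positivity))

theorem sum_dyadicOsc_sq_le {f : ℂ → ℂ} (hf : InDirichlet f) (N : ℕ) :
    ∑ k ∈ Finset.range N, dyadicOsc f k ^ 2 ≤
      12 / Real.pi * ∫ z in ball (0 : ℂ) 1, ‖deriv f z‖ ^ 2 := by
  set I := ∫ z in ball (0 : ℂ) 1, ‖deriv f z‖ ^ 2
  set J : ℕ → ℝ := fun j => ∫ z in dyadicStrip j, ‖deriv f z‖ ^ 2 with hJ
  have hshift : ∀ i, ∑ k ∈ Finset.range N, J (k + i) ≤ I := by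
    intro i
    have h := sum_setIntegral_dyadicStrip_le (fun z => sq_nonneg ‖deriv f z‖) hf.2
      ((Finset.range N).map (addRightEmbedding i)) subset_rfl (fun j _ => dyadicStrip_subset j)
    rwa [Finset.sum_map] at h
  have h3 : ∀ k, dyadicOsc f k ^ 2 = 4 / Real.pi * (J (k + 0) + J (k + 1) + J (k + 2)) := by
    intro k
    rw [dyadicOsc_sq, Finset.sum_Icc_succ_top (by lia), Finset.sum_Icc_succ_top (by lia)]
    simp [hJ]
  simp only [h3]
  rw [← Finset.mul_sum, Finset.sum_add_distrib, Finset.sum_add_distrib]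
  calc _ ≤ 4 / Real.pi * (I + I + I) := by
        gcongr <;> exact hshift _
    _ = _ := by ring

theorem norm_deriv_le_of_mem_dyadic {f : ℂ → ℂ} (hf : InDirichlet f) {k : ℕ} {x : ℝ}
    (hx : x ∈ Icc (1 - (1 / 2 : ℝ) ^ k) (1 - (1 / 2) ^ (k + 1))) :
    ‖deriv f x‖ ≤ 2 ^ (k + 1) * dyadicOsc f k := by
  have hsub := ball_subset_iUnion_dyadicStrip hx
  have hball : ball (x : ℂ) ((1 / 2) ^ (k + 2)) ⊆ ball 0 1 :=
    hsub.trans (iUnion₂_subset fun j _ => dyadicStrip_subset j)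
  have h1 := pi_mul_sq_mul_norm_sq_le_integral_ball ((hf.1.deriv isOpen_ball).mono hball)
    (by positivity) (hf.2.mono_set hball)
  have h2 := h1.trans (setIntegral_le_sum_dyadicStrip (fun z => sq_nonneg ‖deriv f z‖) hf.2 _ hsub)
  refine le_of_sq_le_sq ?_ (mul_nonneg (by positivity) (Real.sqrt_nonneg _))
  rw [mul_pow, dyadicOsc_sq]
  set S := ∑ j ∈ Finset.Icc k (k + 2), ∫ z in dyadicStrip j, ‖deriv f z‖ ^ 2
  have e : (2 : ℝ) ^ (k + 1) * ((1 / 2) ^ (k + 2)) = 1 / 2 := by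
    rw [pow_succ (1 / 2 : ℝ), ← mul_assoc, ← mul_pow]
    norm_num
  have hpi := Real.pi_pos
  calc ‖deriv f x‖ ^ 2
      = 4 / Real.pi * (2 ^ (k + 1) * (1 / 2) ^ (k + 2)) ^ 2 * (Real.pi * ‖deriv f x‖ ^ 2) := by
        rw [e]
        field_simp
        norm_num
    _ = 4 / Real.pi * (2 ^ (k + 1)) ^ 2 *
          (Real.pi * ((1 / 2) ^ (k + 2)) ^ 2 * ‖deriv f x‖ ^ 2) := by ring
    _ ≤ 4 / Real.pi * (2 ^ (k + 1)) ^ 2 * S := by gcongr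
    _ = _ := by ring

theorem norm_sub_le_dyadicOsc {f : ℂ → ℂ} (hf : InDirichlet f) {k : ℕ} {x : ℝ}
    (hx : x ∈ Icc (1 - (1 / 2 : ℝ) ^ k) (1 - (1 / 2) ^ (k + 1))) :
    ‖f x - f ((1 - (1 / 2) ^ k : ℝ) : ℂ)‖ ≤ dyadicOsc f k := by
  set a : ℝ := 1 - (1 / 2) ^ k with ha
  set s : Set ℂ := (fun y : ℝ => (y : ℂ)) '' Icc a (1 - (1 / 2) ^ (k + 1)) with hs
  have hconv : Convex ℝ s := (convex_Icc _ _).linear_image Complex.ofRealCLM.toLinearMap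
  have hdiff : ∀ z ∈ s, DifferentiableAt ℂ f z := by
    rintro _ ⟨y, hy, rfl⟩
    refine hf.1.differentiableAt (isOpen_ball.mem_nhds ?_)
    exact iUnion₂_subset (fun j _ => dyadicStrip_subset j)
      (ball_subset_iUnion_dyadicStrip hy (mem_ball_self (by positivity)))
  have hbd : ∀ z ∈ s, ‖deriv f z‖ ≤ 2 ^ (k + 1) * dyadicOsc f k := by
    rintro _ ⟨y, hy, rfl⟩
    exact norm_deriv_le_of_mem_dyadic hf hy
  have h := hconv.norm_image_sub_le_of_norm_deriv_le hdiff hbd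
    ⟨a, left_mem_Icc.2 (hx.1.trans hx.2), rfl⟩ ⟨x, hx, rfl⟩
  refine h.trans ?_
  have hn : ‖(x : ℂ) - (a : ℂ)‖ ≤ (1 / 2) ^ (k + 1) := by
    rw [← Complex.ofReal_sub, Complex.norm_of_nonneg (sub_nonneg.2 hx.1)]
    have := hx.2
    rw [pow_succ] at this ⊢
    linarith
  have h0 : 0 ≤ dyadicOsc f k := Real.sqrt_nonneg _
  calc _ ≤ 2 ^ (k + 1) * dyadicOsc f k * (1 / 2) ^ (k + 1) := by gcongr
    _ = (2 * (1 / 2)) ^ (k + 1) * dyadicOsc f k := by rw [mul_pow]; ring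
    _ = dyadicOsc f k := by norm_num

theorem norm_le_add_sum_dyadicOsc {f : ℂ → ℂ} (hf : InDirichlet f) {n : ℕ} {x : ℝ}
    (hx : x ∈ Icc (1 - (1 / 2 : ℝ) ^ n) (1 - (1 / 2) ^ (n + 1))) :
    ‖f x‖ ≤ ‖f 0‖ + ∑ k ∈ Finset.range (n + 1), dyadicOsc f k := by
  have hstart : ∀ n : ℕ, ‖f ((1 - (1 / 2) ^ n : ℝ) : ℂ)‖ ≤
      ‖f 0‖ + ∑ k ∈ Finset.range n, dyadicOsc f k := by
    intro n
    induction n with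
    | zero => simp
    | succ n ih =>
      have hle : (1 - (1 / 2 : ℝ) ^ n) ≤ 1 - (1 / 2) ^ (n + 1) := by
        have : (0 : ℝ) < (1 / 2) ^ n := by positivity
        rw [pow_succ]
        linarith
      have h := norm_sub_le_dyadicOsc hf (right_mem_Icc.2 hle)
      have h' := norm_sub_norm_le (f ((1 - (1 / 2) ^ (n + 1) : ℝ) : ℂ))
        (f ((1 - (1 / 2) ^ n : ℝ) : ℂ))
      rw [Finset.sum_range_succ]
      linarith
  have h := norm_sub_le_dyadicOsc hf hx
  have h' := norm_sub_norm_le (f x) (f ((1 - (1 / 2) ^ n : ℝ) : ℂ))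
  have h'' := hstart n
  rw [Finset.sum_range_succ]
  linarith

/-- The points `x ∈ [1 - t, 1)` of the radius, as complex numbers. -/
def radiusTail (t : ℝ) : Set ℂ := {z : ℂ | ∃ x : ℝ, 1 - t ≤ x ∧ x < 1 ∧ z = (x : ℂ)}

theorem measurableSet_radiusTail (t : ℝ) : MeasurableSet (radiusTail t) := by
  have : radiusTail t = (fun x : ℝ => (x : ℂ)) '' Ico (1 - t) 1 := by
    ext z
    simp only [radiusTail, mem_ofPred_eq, mem_image, mem_Ico]
    grind
  rw [this]
  exact Complex.isometry_ofReal.isClosedEmbedding.measurableEmbedding.measurableSet_image.2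
    measurableSet_Ico

theorem measure_dyadic_radius {μ : Measure ℂ} [IsFiniteMeasure μ]
    (hμ : ∀ t : ℝ, 0 < t → t ≤ 1 → μ (radiusTail t) = ENNReal.ofReal (Real.log (2 / t))⁻¹)
    (n : ℕ) :
    μ (radiusTail ((1 / 2) ^ n) \ radiusTail ((1 / 2) ^ (n + 1))) =
      ENNReal.ofReal ((Real.log 2)⁻¹ * (1 / ((n + 1) * (n + 2)))) := by
  have hlog : ∀ m : ℕ, Real.log (2 / (1 / 2) ^ m) = (m + 1) * Real.log 2 := by
    intro m
    have : (2 : ℝ) / (1 / 2) ^ m = 2 ^ (m + 1) := by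
      rw [one_div, inv_pow, div_inv_eq_mul, pow_succ']
    rw [this, Real.log_pow]
    push_cast
    rfl
  have hsub : radiusTail ((1 / 2) ^ (n + 1)) ⊆ radiusTail ((1 / 2) ^ n) := by
    rintro z ⟨x, h1, h2, rfl⟩
    refine ⟨x, le_trans ?_ h1, h2, rfl⟩
    have : (0 : ℝ) < (1 / 2) ^ n := by positivity
    rw [pow_succ]
    linarith
  have hl2 : 0 < Real.log 2 := Real.log_pos one_lt_two
  have htail : ∀ m : ℕ, μ (radiusTail ((1 / 2) ^ m)) =
      ENNReal.ofReal (((m : ℝ) + 1) * Real.log 2)⁻¹ := fun m => by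
    rw [hμ _ (by positivity) (pow_le_one₀ (by norm_num) (by norm_num)), hlog]
  rw [measure_sdiff hsub (measurableSet_radiusTail _).nullMeasurableSet (measure_ne_top _ _),
    htail, htail, ← ENNReal.ofReal_sub _ (by positivity)]
  congr 1
  push_cast
  field_simp
  ring

theorem radius_subset_iUnion_dyadic :
    {z : ℂ | ∃ x : ℝ, 0 ≤ x ∧ x < 1 ∧ z = (x : ℂ)} ⊆
      ⋃ n : ℕ, radiusTail ((1 / 2) ^ n) \ radiusTail ((1 / 2) ^ (n + 1)) := by
  rintro z ⟨x, h0, h1, rfl⟩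
  obtain ⟨n, h2, h3⟩ := exists_nat_pow_near_of_lt_one (x := 1 - x) (y := 1 / 2) (by linarith)
    (by linarith) (by norm_num) (by norm_num)
  refine mem_iUnion.2 ⟨n, ⟨x, by linarith, h1, rfl⟩, ?_⟩
  rintro ⟨y, hy1, -, hxy⟩
  rw [Complex.ofReal_inj] at hxy
  linarith

theorem sum_measure_mul_sq_le {f : ℂ → ℂ} (hf : InDirichlet f) (N : ℕ) :
    ∑ n ∈ Finset.range N, (Real.log 2)⁻¹ * (1 / (((n : ℝ) + 1) * (n + 2))) *
        (‖f 0‖ + ∑ k ∈ Finset.range (n + 1), dyadicOsc f k) ^ 2 ≤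
      144 / Real.log 2 * dirichletNormSq f := by
  have hl2 : 0 < Real.log 2 := Real.log_pos one_lt_two
  have htel : ∑ n ∈ Finset.range N, 1 / (((n : ℝ) + 1) * (n + 2)) ≤ 1 := by
    have : ∑ n ∈ Finset.range N, 1 / (((n : ℝ) + 1) * (n + 2)) = 1 - 1 / ((N : ℝ) + 1) := by
      induction N with
      | zero => simp
      | succ N ih =>
        rw [Finset.sum_range_succ, ih]
        push_cast
        field_simp
        ring
    rw [this]
    have : 0 ≤ 1 / ((N : ℝ) + 1) := by positivity
    linarith
  have hardy := sum_sq_sum_range_div_le (dyadicOsc f) N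
  have hosc := sum_dyadicOsc_sq_le hf N
  set I := ∫ z in ball (0 : ℂ) 1, ‖deriv f z‖ ^ 2 with hI
  have hterm : ∀ n ∈ Finset.range N, (Real.log 2)⁻¹ * (1 / (((n : ℝ) + 1) * (n + 2))) *
        (‖f 0‖ + ∑ k ∈ Finset.range (n + 1), dyadicOsc f k) ^ 2 ≤
      (Real.log 2)⁻¹ * (2 * ‖f 0‖ ^ 2 * (1 / (((n : ℝ) + 1) * (n + 2))) +
        2 * ((∑ k ∈ Finset.range (n + 1), dyadicOsc f k) ^ 2 / (((n : ℝ) + 1) * (n + 2)))) := by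
    intro n _
    calc _ ≤ (Real.log 2)⁻¹ * (1 / (((n : ℝ) + 1) * (n + 2))) *
          (2 * (‖f 0‖ ^ 2 + (∑ k ∈ Finset.range (n + 1), dyadicOsc f k) ^ 2)) := by
          gcongr
          exact add_sq_le
      _ = _ := by ring
  refine (Finset.sum_le_sum hterm).trans ?_
  rw [← Finset.mul_sum, Finset.sum_add_distrib, ← Finset.mul_sum, ← Finset.mul_sum,
    dirichletNormSq, ← hI, div_eq_inv_mul, mul_assoc (Real.log 2)⁻¹]
  refine mul_le_mul_of_nonneg_left ?_ (inv_nonneg.2 hl2.le)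
  have e : 12 / Real.pi * I = 12 * (1 / Real.pi * I) := by ring
  have h0 := mul_le_mul_of_nonneg_left htel (by positivity : 0 ≤ 2 * ‖f 0‖ ^ 2)
  have h1 : 0 ≤ ‖f 0‖ ^ 2 := by positivity
  linarith

/-- The measure on the radius `[0,1) ⊂ 𝔻` with distribution `μ([1-t,1)) = (log(2/t))⁻¹`
is a Carleson measure for the Dirichlet space. -/
theorem statement16 (μ : Measure ℂ) [IsFiniteMeasure μ]
    (hμsupp : μ {z : ℂ | ∃ x : ℝ, 0 ≤ x ∧ x < 1 ∧ z = (x : ℂ)}ᶜ = 0)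
    (hμ : ∀ t : ℝ, 0 < t → t ≤ 1 →
      μ {z : ℂ | ∃ x : ℝ, 1 - t ≤ x ∧ x < 1 ∧ z = (x : ℂ)} =
        ENNReal.ofReal (Real.log (2 / t))⁻¹) :
    IsCarlesonDirichlet μ := by
  refine ⟨144 / Real.log 2, fun f hf => ?_⟩
  have hl2 : 0 < Real.log 2 := Real.log_pos one_lt_two
  set M : ℕ → Set ℂ := fun n => radiusTail ((1 / 2) ^ n) \ radiusTail ((1 / 2) ^ (n + 1)) with hM
  set A : ℕ → ℝ := fun n => ‖f 0‖ + ∑ k ∈ Finset.range (n + 1), dyadicOsc f k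
  have hMm : ∀ n, MeasurableSet (M n) := fun n =>
    (measurableSet_radiusTail _).diff (measurableSet_radiusTail _)
  have hcover : ∀ᵐ z ∂μ, z ∈ ⋃ n, M n :=
    mem_of_superset (mem_ae_iff.2 hμsupp) radius_subset_iUnion_dyadic
  have hpoint : ∀ n, ∀ z ∈ M n, ENNReal.ofReal (‖f z‖ ^ 2) ≤ ENNReal.ofReal (A n ^ 2) := by
    rintro n _ ⟨⟨x, h1, h2, rfl⟩, h3⟩
    have hx : x ≤ 1 - (1 / 2) ^ (n + 1) := by
      by_contra! h
      exact h3 ⟨x, h.le, h2, rfl⟩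
    gcongr
    exact norm_le_add_sum_dyadicOsc hf ⟨h1, hx⟩
  calc ∫⁻ z in ball (0 : ℂ) 1, ENNReal.ofReal (‖f z‖ ^ 2) ∂μ
      ≤ ∫⁻ z, ENNReal.ofReal (‖f z‖ ^ 2) ∂μ := setLIntegral_le_lintegral _ _
    _ = ∫⁻ z in ⋃ n, M n, ENNReal.ofReal (‖f z‖ ^ 2) ∂μ := by
        rw [Measure.restrict_eq_self_of_ae_mem hcover]
    _ ≤ ∑' n, ∫⁻ z in M n, ENNReal.ofReal (‖f z‖ ^ 2) ∂μ := lintegral_iUnion_le _ _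
    _ ≤ ∑' n : ℕ, ENNReal.ofReal
          ((Real.log 2)⁻¹ * (1 / (((n : ℝ) + 1) * (n + 2))) * A n ^ 2) := by
        refine ENNReal.tsum_le_tsum fun n => ?_
        refine (setLIntegral_mono' (hMm n) (hpoint n)).trans (le_of_eq ?_)
        rw [setLIntegral_const, measure_dyadic_radius hμ n, mul_comm,
          ← ENNReal.ofReal_mul (by positivity)]
    _ ≤ ENNReal.ofReal (144 / Real.log 2 * dirichletNormSq f) := by
        refine ENNReal.tsum_le_of_sum_range_le fun N => ?_
        rw [← ENNReal.ofReal_sum_of_nonneg fun n _ => by positivity]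
        exact ENNReal.ofReal_le_ofReal (sum_measure_mul_sq_le hf N)

end
end
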